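/- arXiv:0904.1385 — 8 statements merged into one kernel-verified Lean document; each statement's English description precedes it below -/
import Mathlib

section
/- (Dubé–Mingarelli.) Let t₀ ≥ 0, M > 0, and let f : [t₀,∞) × ℝ → [0,∞) be continuous such that ∫_{t₀}^∞ (t−t₀)·f(t,u(t)) dt ≤ M for every u ∈ X_M. Suppose there is a continuous k : [t₀,∞) → [0,∞) with η := ∫_{t₀}^∞ (t−t₀)·k(t) dt < 1 and |f(t,u₂(t)) − f(t,u₁(t))| ≤ k(t)·|u₂(t) − u₁(t)| for all t ≥ t₀ and all u₁, u₂ ∈ X_M. Then the differential equation x''(t) + f(t,x(t)) = 0 has a solution x defined on [t₀,∞) with lim_{t→∞} x(t) = M. -/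
open Real MeasureTheory Filter Topology Set Asymptotics

/-- Membership in `X_M`: continuous on `[t₀,∞)` with values in `[0,M]`. -/
def memXM (t₀ M : ℝ) (u : ℝ → ℝ) : Prop :=
  ContinuousOn u (Set.Ici t₀) ∧ ∀ t ∈ Set.Ici t₀, 0 ≤ u t ∧ u t ≤ M

/-- A continuous function on a half-line with a finite first moment is integrable. -/
theorem integrableOn_Ioi_of_integrableOn_sub_mul {a : ℝ} {g : ℝ → ℝ} (hg : Continuous g)
    (hint : IntegrableOn (fun s => (s - a) * g s) (Ioi a)) : IntegrableOn g (Ioi a) := by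
  rw [← Ioc_union_Ioi_eq_Ioi (show a ≤ a + 1 by linarith)]
  refine IntegrableOn.union ?_ ?_
  · exact (hg.integrableOn_Icc).mono_set Ioc_subset_Icc_self
  · refine Integrable.mono (hint.mono_set (Ioi_subset_Ioi (by linarith)))
      hg.aestronglyMeasurable ?_
    refine (ae_restrict_iff' measurableSet_Ioi).2 (Eventually.of_forall fun s hs => ?_)
    have hs' : 1 ≤ s - a := by
      have : a + 1 < s := hs
      linarith
    rw [norm_mul, Real.norm_of_nonneg (by linarith : (0 : ℝ) ≤ s - a)]
    exact le_mul_of_one_le_left (norm_nonneg _) hs'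

/-- A second antiderivative of `g` vanishing at infinity, given on `[a,∞)` by
`t ↦ ∫_t^∞ (s-t) g(s) ds`. -/
theorem exists_second_antideriv_tendsto_zero {a : ℝ} {g : ℝ → ℝ} (hg : Continuous g)
    (hg_nonneg : ∀ s ∈ Ioi a, 0 ≤ g s)
    (hint : IntegrableOn (fun s => (s - a) * g s) (Ioi a)) :
    ∃ W G : ℝ → ℝ, (∀ t, HasDerivAt W (-G t) t) ∧ (∀ t, HasDerivAt G (-g t) t) ∧
      Tendsto W atTop (𝓝 0) ∧ (∀ t ∈ Ici a, W t = ∫ s in Ioi t, (s - t) * g s) := by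
  have hgi := integrableOn_Ioi_of_integrableOn_sub_mul hg hint
  have hh : Continuous fun s => (s - a) * g s := by fun_prop
  set G : ℝ → ℝ := fun t => (∫ s in Ioi a, g s) - ∫ s in a..t, g s with hG
  set H : ℝ → ℝ := fun t => (∫ s in Ioi a, (s - a) * g s) - ∫ s in a..t, (s - a) * g s with hH
  have dG : ∀ t, HasDerivAt G (-g t) t := fun t => by
    simpa using (hg.integral_hasStrictDerivAt a t).hasDerivAt.const_sub (∫ s in Ioi a, g s)
  have dH : ∀ t, HasDerivAt H (-((t - a) * g t)) t := fun t => by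
    simpa using (hh.integral_hasStrictDerivAt a t).hasDerivAt.const_sub
      (∫ s in Ioi a, (s - a) * g s)
  have tail : ∀ φ : ℝ → ℝ, IntegrableOn φ (Ioi a) → ∀ t ∈ Ici a,
      (∫ s in Ioi a, φ s) - ∫ s in a..t, φ s = ∫ s in Ioi t, φ s := fun φ hφ t ht => by
    have := intervalIntegral.integral_Ioi_sub_Ioi hφ ht
    linarith
  have hW : ∀ t ∈ Ici a, H t - (t - a) * G t = ∫ s in Ioi t, (s - t) * g s := fun t ht => by
    simp only [hG, hH]
    rw [tail _ hgi t ht, tail _ hint t ht, ← integral_const_mul, ← integral_sub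
      (hint.mono_set (Ioi_subset_Ioi ht)) ((hgi.mono_set (Ioi_subset_Ioi ht)).const_mul _)]
    congr 1
    ext s
    ring
  refine ⟨fun t => H t - (t - a) * G t, G, fun t => ?_, dG, ?_, hW⟩
  · refine ((dH t).sub (((hasDerivAt_id' t).sub_const a).mul (dG t))).congr_deriv ?_
    ring
  · have hH0 : Tendsto H atTop (𝓝 0) := by
      simpa [hH] using (intervalIntegral_tendsto_integral_Ioi a hint tendsto_id).const_sub
        (∫ s in Ioi a, (s - a) * g s)
    refine tendsto_of_tendsto_of_tendsto_of_le_of_le' tendsto_const_nhds hH0 ?_ ?_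
    · filter_upwards [eventually_ge_atTop a] with t ht
      rw [hW t ht]
      refine setIntegral_nonneg measurableSet_Ioi fun s hs => ?_
      exact mul_nonneg (sub_nonneg.2 (le_of_lt hs)) (hg_nonneg s (lt_of_le_of_lt ht hs))
    · filter_upwards [eventually_ge_atTop a] with t ht
      have : 0 ≤ G t := by
        simp only [hG]
        rw [tail _ hgi t ht]
        exact setIntegral_nonneg measurableSet_Ioi fun s hs =>
          hg_nonneg s (lt_of_le_of_lt ht hs)
      have := mul_nonneg (sub_nonneg.2 ht) this
      linarith

/-- Shifting the base point of a first moment to the right preserves integrability. -/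
theorem integrableOn_Ioi_sub_mul_of_le {a t : ℝ} {g : ℝ → ℝ} (hg : Continuous g) (hat : a ≤ t)
    (hint : IntegrableOn (fun s => (s - a) * g s) (Ioi a)) :
    IntegrableOn (fun s => (s - t) * g s) (Ioi t) := by
  have h₁ := hint.mono_set (Ioi_subset_Ioi hat)
  have h₂ := (integrableOn_Ioi_of_integrableOn_sub_mul hg hint).mono_set (Ioi_subset_Ioi hat)
  refine (h₁.sub (h₂.const_mul (t - a))).congr (Eventually.of_forall fun s => ?_)
  simp only [Pi.sub_apply]
  ring

/-- The tail first moment is dominated by the full weighted integral of any majorant. -/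
theorem abs_integral_Ioi_sub_mul_le {a t : ℝ} {g h : ℝ → ℝ} (hat : a ≤ t)
    (hgh : ∀ s ∈ Ioi a, |g s| ≤ h s)
    (hint : IntegrableOn (fun s => (s - a) * h s) (Ioi a)) :
    |∫ s in Ioi t, (s - t) * g s| ≤ ∫ s in Ioi a, (s - a) * h s := by
  have h₁ : |∫ s in Ioi t, (s - t) * g s| ≤ ∫ s in Ioi t, (s - a) * h s := by
    rw [← Real.norm_eq_abs]
    refine norm_integral_le_of_norm_le (hint.mono_set (Ioi_subset_Ioi hat)) ?_
    refine (ae_restrict_iff' measurableSet_Ioi).2 (Eventually.of_forall fun s hs => ?_)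
    have hs' : t < s := hs
    rw [norm_mul, Real.norm_of_nonneg (sub_nonneg.2 hs'.le), Real.norm_eq_abs]
    exact mul_le_mul (by linarith) (hgh s (lt_of_le_of_lt hat hs')) (abs_nonneg _) (by linarith)
  refine h₁.trans (setIntegral_mono_set hint ?_ (Ioi_subset_Ioi hat).eventuallyLE)
  refine (ae_restrict_iff' measurableSet_Ioi).2 (Eventually.of_forall fun s hs => ?_)
  exact mul_nonneg (sub_nonneg.2 (le_of_lt hs)) ((abs_nonneg _).trans (hgh s hs))

/-- **Dubé–Mingarelli.** If `∫_{t₀}^∞ (t-t₀)·f(t,u(t)) dt ≤ M` for all `u ∈ X_M`, and `f`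
is Lipschitz along `X_M` with continuous coefficient `k` satisfying
`η = ∫_{t₀}^∞ (t-t₀)·k(t) dt < 1`, then `x'' + f(t,x) = 0` has a solution on `[t₀,∞)`
with `x(t) → M` as `t → ∞`. -/
theorem stmt_5 (t₀ M : ℝ) (ht₀ : 0 ≤ t₀) (hM : 0 < M)
    (f : ℝ → ℝ → ℝ)
    (hf_cont : ContinuousOn (fun p : ℝ × ℝ => f p.1 p.2) (Set.Ici t₀ ×ˢ Set.univ))
    (hf_nonneg : ∀ t ∈ Set.Ici t₀, ∀ u : ℝ, 0 ≤ f t u)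
    (hf_int : ∀ u : ℝ → ℝ, memXM t₀ M u →
      IntegrableOn (fun t => (t - t₀) * f t (u t)) (Set.Ici t₀) ∧
      (∫ t in Set.Ici t₀, (t - t₀) * f t (u t)) ≤ M)
    (k : ℝ → ℝ) (hk_cont : ContinuousOn k (Set.Ici t₀))
    (hk_nonneg : ∀ t ∈ Set.Ici t₀, 0 ≤ k t)
    (hk_int : IntegrableOn (fun t => (t - t₀) * k t) (Set.Ici t₀))
    (hη : (∫ t in Set.Ici t₀, (t - t₀) * k t) < 1)
    (hlip : ∀ u₁ u₂ : ℝ → ℝ, memXM t₀ M u₁ → memXM t₀ M u₂ → ∀ t ∈ Set.Ici t₀,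
      |f t (u₂ t) - f t (u₁ t)| ≤ k t * |u₂ t - u₁ t|) :
    ∃ x x' : ℝ → ℝ,
      (∀ t ∈ Set.Ici t₀, HasDerivAt x (x' t) t ∧ HasDerivAt x' (-f t (x t)) t) ∧
      Tendsto x atTop (𝓝 M) := by
  let S : Set (BoundedContinuousFunction ℝ ℝ) := {u | ∀ t, 0 ≤ u t ∧ u t ≤ M}
  have hS_closed : IsClosed S := by
    have : S = ⋂ t, {u : BoundedContinuousFunction ℝ ℝ | u t ∈ Icc 0 M} := by
      ext u
      simp [S]
    rw [this]
    exact isClosed_iInter fun t =>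
      isClosed_Icc.preimage (by fun_prop : Continuous fun u : BoundedContinuousFunction ℝ ℝ => u t)
  have : CompleteSpace S := hS_closed.completeSpace_coe
  have : Nonempty S := ⟨⟨0, fun t => ⟨le_rfl, hM.le⟩⟩⟩
  let g : S → ℝ → ℝ := fun u s => f (max s t₀) (u.1 (max s t₀))
  have hmem : ∀ u : S, memXM t₀ M u.1 := fun u => ⟨u.1.continuous.continuousOn, fun t _ => u.2 t⟩
  have hg_eq : ∀ u : S, ∀ s ∈ Ici t₀, g u s = f s (u.1 s) := fun u s hs => by
    simp only [g, max_eq_left (show t₀ ≤ s from hs)]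
  have hg_cont : ∀ u, Continuous (g u) := fun u => by
    refine hf_cont.comp_continuous (f := fun s => (max s t₀, u.1 (max s t₀))) (by fun_prop)
      fun s => ⟨mem_Ici.2 (le_max_right _ _), trivial⟩
  have hg_nonneg : ∀ u s, 0 ≤ g u s := fun u s => hf_nonneg _ (mem_Ici.2 (le_max_right _ _)) _
  have hg_int : ∀ u, IntegrableOn (fun s => (s - t₀) * g u s) (Ioi t₀) ∧
      ∫ s in Ioi t₀, (s - t₀) * g u s ≤ M := fun u => by
    obtain ⟨h₁, h₂⟩ := hf_int u.1 (hmem u)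
    have e : EqOn (fun s => (s - t₀) * f s (u.1 s)) (fun s => (s - t₀) * g u s) (Ioi t₀) :=
      fun s hs => by simp only [hg_eq u s (Ioi_subset_Ici_self hs)]
    rw [integral_Ici_eq_integral_Ioi, setIntegral_congr_fun measurableSet_Ioi e] at h₂
    exact ⟨(h₁.mono_set Ioi_subset_Ici_self).congr_fun e measurableSet_Ioi, h₂⟩
  choose W G dW dG W_lim W_eq using fun u => exists_second_antideriv_tendsto_zero (hg_cont u)
    (fun s _ => hg_nonneg u s) (hg_int u).1
  have W_nonneg : ∀ u, ∀ t ∈ Ici t₀, 0 ≤ W u t := fun u t ht => by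
    rw [W_eq u t ht]
    exact setIntegral_nonneg measurableSet_Ioi fun s hs =>
      mul_nonneg (sub_nonneg.2 (le_of_lt hs)) (hg_nonneg u s)
  have W_le : ∀ u, ∀ t ∈ Ici t₀, W u t ≤ M := fun u t ht => by
    rw [W_eq u t ht]
    exact (le_abs_self _).trans ((abs_integral_Ioi_sub_mul_le ht
      (fun s _ => (abs_of_nonneg (hg_nonneg u s)).le) (hg_int u).1).trans (hg_int u).2)
  have W_cont : ∀ u, Continuous (W u) := fun u =>
    continuous_iff_continuousAt.2 fun t => (dW u t).continuousAt
  have hT : ∀ u : S, ∀ t, 0 ≤ M - W u (max t t₀) ∧ M - W u (max t t₀) ≤ M := fun u t =>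
    ⟨sub_nonneg.2 (W_le u _ (mem_Ici.2 (le_max_right _ _))),
      sub_le_self _ (W_nonneg u _ (mem_Ici.2 (le_max_right _ _)))⟩
  let T : S → S := fun u =>
    ⟨BoundedContinuousFunction.ofNormedAddCommGroup (fun t => M - W u (max t t₀))
      (by have := W_cont u; fun_prop) M
      (fun t => by rw [Real.norm_of_nonneg (hT u t).1]; exact (hT u t).2), hT u⟩
  have hk_int' := hk_int.mono_set Ioi_subset_Ici_self
  rw [integral_Ici_eq_integral_Ioi] at hη
  have hη_nonneg : 0 ≤ ∫ s in Ioi t₀, (s - t₀) * k s :=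
    setIntegral_nonneg measurableSet_Ioi fun s hs =>
      mul_nonneg (sub_nonneg.2 (le_of_lt hs)) (hk_nonneg s (Ioi_subset_Ici_self hs))
  have W_dist : ∀ u v : S, ∀ t ∈ Ici t₀,
      |W u t - W v t| ≤ (∫ s in Ioi t₀, (s - t₀) * k s) * dist u v := fun u v t ht => by
    rw [W_eq u t ht, W_eq v t ht, ← integral_sub
      (integrableOn_Ioi_sub_mul_of_le (hg_cont u) ht (hg_int u).1)
      (integrableOn_Ioi_sub_mul_of_le (hg_cont v) ht (hg_int v).1), ← integral_mul_const]
    simp only [← mul_sub, mul_assoc]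
    refine abs_integral_Ioi_sub_mul_le ht (fun s hs => ?_)
      (by simpa only [IntegrableOn, mul_assoc] using hk_int'.mul_const (dist u v))
    rw [hg_eq u s (Ioi_subset_Ici_self hs), hg_eq v s (Ioi_subset_Ici_self hs)]
    refine (hlip v.1 u.1 (hmem v) (hmem u) s (Ioi_subset_Ici_self hs)).trans ?_
    exact mul_le_mul_of_nonneg_left
      (BoundedContinuousFunction.dist_coe_le_dist (f := u.1) (g := v.1) s)
      (hk_nonneg s (Ioi_subset_Ici_self hs))
  have hT_contr : ContractingWith ⟨_, hη_nonneg⟩ T := by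
    refine ⟨hη, LipschitzWith.of_dist_le_mul fun u v => ?_⟩
    refine (BoundedContinuousFunction.dist_le (mul_nonneg hη_nonneg dist_nonneg)).2 fun t => ?_
    change dist (M - W u (max t t₀)) (M - W v (max t t₀)) ≤ _
    rw [dist_sub_left, Real.dist_eq]
    exact W_dist u v _ (mem_Ici.2 (le_max_right _ _))
  obtain ⟨u, hu⟩ : ∃ u, T u = u := ⟨_, hT_contr.fixedPoint_isFixedPt⟩
  have hu_eq : ∀ t ∈ Ici t₀, u.1 t = M - W u t := fun t ht => by
    have : M - W u (max t t₀) = u.1 t := congrArg (fun v : S => v.1 t) hu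
    rw [← this, max_eq_left (show t₀ ≤ t from ht)]
  refine ⟨fun t => M - W u t, G u, fun t ht => ⟨?_, ?_⟩, ?_⟩
  · simpa using (dW u t).const_sub M
  · have := dG u t
    rwa [hg_eq u t ht, hu_eq t ht] at this
  · simpa using (W_lim u).const_sub M
end

section
/- (Improved Atkinson claim.) Let t₀ ≥ 1, λ > 1, and let q : [t₀,∞) → [0,∞) be continuous with η := λ·∫_{t₀}^∞ t·q(t) dt < 1. Then there exists p > 1 such that, for every c ∈ (0,1], the Emden–Fowler equation x''(t) + q(t)·x(t)^λ = 0 has at least one solution x defined on [t₀,∞) with c/p ≤ x(t) ≤ c for all t ≥ t₀, and moreover x(t) = c + o(1) and x'(t) = o(t^{−1}) as t → ∞. -/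
open Real MeasureTheory Filter Topology Set Asymptotics

/-- The signed power `x^λ := |x|^(λ-1) · x` used in the Emden-Fowler equation. -/
noncomputable def efPow (lam x : ℝ) : ℝ := |x| ^ (lam - 1) * x

/-- The tail kernel `max (s - t) 0` is dominated by the weight `s`. -/
lemma norm_tail_kernel_mul_le {s t : ℝ} (hs : 0 ≤ s) (ht : 0 ≤ t) (a : ℝ) :
    ‖max (s - t) 0 * a‖ ≤ s * |a| := by
  rw [Real.norm_eq_abs, abs_mul, abs_of_nonneg (le_max_right _ _)]
  exact mul_le_mul_of_nonneg_right (max_le (by linarith) hs) (abs_nonneg a)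

lemma integrableOn_of_weighted {t₀ : ℝ} (ht₀ : 1 ≤ t₀) {g : ℝ → ℝ} (hg : Continuous g)
    (hi : IntegrableOn (fun s => s * g s) (Ici t₀)) : IntegrableOn g (Ici t₀) := by
  refine Integrable.mono hi hg.aestronglyMeasurable ?_
  refine (ae_restrict_iff' measurableSet_Ici).2 (Eventually.of_forall fun s hs => ?_)
  have hs' : 1 ≤ s := ht₀.trans hs
  rw [norm_mul, Real.norm_eq_abs s, abs_of_nonneg (by linarith)]
  exact le_mul_of_one_le_left (norm_nonneg _) hs'

lemma integrableOn_tail_kernel {t₀ : ℝ} (ht₀ : 1 ≤ t₀) {g : ℝ → ℝ} (hg : Continuous g)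
    (hi : IntegrableOn (fun s => s * g s) (Ici t₀)) {t : ℝ} (ht : 0 ≤ t) :
    IntegrableOn (fun s => max (s - t) 0 * g s) (Ici t₀) := by
  refine Integrable.mono hi (by fun_prop) ?_
  refine (ae_restrict_iff' measurableSet_Ici).2 (Eventually.of_forall fun s hs => ?_)
  have hs' : 0 ≤ s := by linarith [mem_Ici.1 hs]
  refine (norm_tail_kernel_mul_le hs' ht _).trans (le_of_eq ?_)
  rw [norm_mul, Real.norm_eq_abs, Real.norm_eq_abs, abs_of_nonneg hs']

lemma continuous_tail_integral {t₀ : ℝ} (ht₀ : 1 ≤ t₀) {g : ℝ → ℝ} (hg : Continuous g)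
    (hi : IntegrableOn (fun s => s * g s) (Ici t₀)) :
    Continuous fun t => ∫ s in Ici t₀, max (s - max t t₀) 0 * g s := by
  refine continuous_of_dominated (bound := fun s => ‖s * g s‖) ?_ ?_ hi.norm ?_
  · intro t
    fun_prop
  · intro t
    refine (ae_restrict_iff' measurableSet_Ici).2 (Eventually.of_forall fun s hs => ?_)
    have hs' : 0 ≤ s := by linarith [mem_Ici.1 hs]
    refine (norm_tail_kernel_mul_le hs' (by linarith [le_max_right t t₀]) _).trans (le_of_eq ?_)
    rw [norm_mul, Real.norm_eq_abs, Real.norm_eq_abs, abs_of_nonneg hs']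
  · exact Eventually.of_forall fun s => by fun_prop

/-- The power `u ^ lam` precomposed with the projection of the line onto `[0, c]`. -/
noncomputable def clampedPow (lam c u : ℝ) : ℝ := (max 0 (min u c)) ^ lam

lemma continuous_clampedPow {lam : ℝ} (hlam : 1 < lam) (c : ℝ) :
    Continuous (clampedPow lam c) := by
  unfold clampedPow
  exact (continuous_const.max (continuous_id.min continuous_const)).rpow_const
    fun _ => Or.inr (by linarith)

lemma clampedPow_nonneg (lam c u : ℝ) : 0 ≤ clampedPow lam c u :=
  Real.rpow_nonneg (le_max_left _ _) _

lemma clampedPow_le {lam c : ℝ} (hlam : 1 < lam) (hc : c ∈ Ioc (0 : ℝ) 1) (u : ℝ) :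
    clampedPow lam c u ≤ c := by
  have h : max 0 (min u c) ≤ c := max_le hc.1.le (min_le_right _ _)
  refine (Real.rpow_le_self_of_le_one (le_max_left _ _) (h.trans hc.2) hlam.le).trans h

lemma clampedPow_eq_efPow {lam c u : ℝ} (hu : 0 < u) (huc : u ≤ c) :
    clampedPow lam c u = efPow lam u := by
  unfold clampedPow efPow
  rw [min_eq_left huc, max_eq_right hu.le, abs_of_pos hu, Real.rpow_sub_one hu.ne',
    div_mul_cancel₀ _ hu.ne']

lemma abs_clampedPow_sub_le {lam c : ℝ} (hlam : 1 < lam) (hc : c ∈ Ioc (0 : ℝ) 1) (u v : ℝ) :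
    |clampedPow lam c u - clampedPow lam c v| ≤ lam * |u - v| := by
  have key : ∀ a ∈ Icc (0 : ℝ) 1, ∀ b ∈ Icc (0 : ℝ) 1, ‖a ^ lam - b ^ lam‖ ≤ lam * ‖a - b‖ := by
    intro a ha b hb
    refine (convex_Icc (0 : ℝ) 1).norm_image_sub_le_of_norm_hasDerivWithin_le
      (f' := fun y => lam * y ^ (lam - 1))
      (fun y _ => (Real.hasDerivAt_rpow_const (Or.inr hlam.le)).hasDerivWithinAt) ?_ hb ha
    intro y hy
    have h0 : 0 ≤ y ^ (lam - 1) := Real.rpow_nonneg hy.1 _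
    have h1 : y ^ (lam - 1) ≤ 1 := Real.rpow_le_one hy.1 hy.2 (by linarith)
    rw [Real.norm_eq_abs, abs_of_nonneg (by positivity)]
    nlinarith
  have hmem : ∀ w : ℝ, max 0 (min w c) ∈ Icc (0 : ℝ) 1 := fun w =>
    ⟨le_max_left _ _, max_le zero_le_one ((min_le_right _ _).trans hc.2)⟩
  refine (key _ (hmem u) _ (hmem v)).trans (mul_le_mul_of_nonneg_left ?_ (by linarith))
  rw [Real.norm_eq_abs, max_comm 0, max_comm 0]
  refine (abs_max_sub_max_le_abs _ _ _).trans ?_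
  simpa using abs_min_sub_min_le_max u c v c

/-- Solution of `x = c - ∫_t^∞ (s - t) Q(s) φ(x(s)) ds` for a bounded Lipschitz nonlinearity `φ`,
with Lipschitz constant small relative to the weighted integral of `Q`. -/
lemma exists_fixed_point {t₀ lam c C : ℝ} (ht₀ : 1 ≤ t₀) (hlam : 0 ≤ lam)
    {Q : ℝ → ℝ} (hQ : Continuous Q) (hQ0 : ∀ t, 0 ≤ Q t)
    (hi : IntegrableOn (fun t => t * Q t) (Ici t₀))
    (hη : lam * ∫ t in Ici t₀, t * Q t < 1)
    {φ : ℝ → ℝ} (hφ : Continuous φ) (hφC : ∀ u, |φ u| ≤ C)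
    (hφL : ∀ u v, |φ u - φ v| ≤ lam * |u - v|) :
    ∃ x : ℝ → ℝ, Continuous x ∧
      ∀ t, x t = c - ∫ s in Ici t₀, max (s - max t t₀) 0 * (Q s * φ (x s)) := by
  have hint : ∀ x : ℝ → ℝ, Continuous x →
      IntegrableOn (fun s => s * (Q s * φ (x s))) (Ici t₀) := by
    intro x hx
    refine Integrable.mono (hi.mul_const C) (by fun_prop) (Eventually.of_forall fun s => ?_)
    have hC : 0 ≤ C := (abs_nonneg _).trans (hφC 0)
    rw [← mul_assoc, norm_mul, norm_mul (s * Q s), Real.norm_eq_abs C, abs_of_nonneg hC]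
    exact mul_le_mul_of_nonneg_left (hφC _) (norm_nonneg _)
  have hcont : ∀ x : ℝ → ℝ, Continuous x → Continuous fun s => Q s * φ (x s) := by
    intro x hx
    fun_prop
  have hle : ∀ {g b : ℝ → ℝ} (_ : IntegrableOn b (Ici t₀)) (_ : ∀ s ∈ Ici t₀, s * |g s| ≤ b s)
      (t : ℝ), |∫ s in Ici t₀, max (s - max t t₀) 0 * g s| ≤ ∫ s in Ici t₀, b s := by
    intro g b hb hgb t
    rw [← Real.norm_eq_abs]
    refine norm_integral_le_of_norm_le hb ?_
    refine (ae_restrict_iff' measurableSet_Ici).2 (Eventually.of_forall fun s hs => ?_)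
    exact (norm_tail_kernel_mul_le (by linarith [mem_Ici.1 hs])
      (by linarith [le_max_right t t₀]) _).trans (hgb s hs)
  let T : BoundedContinuousFunction ℝ ℝ → BoundedContinuousFunction ℝ ℝ := fun x =>
    BoundedContinuousFunction.ofNormedAddCommGroup
      (fun t => c - ∫ s in Ici t₀, max (s - max t t₀) 0 * (Q s * φ (x s)))
      (continuous_const.sub (continuous_tail_integral ht₀ (hcont x x.continuous)
        (hint x x.continuous)))
      (|c| + ∫ s in Ici t₀, ‖s * (Q s * φ (x s))‖)
      (fun t => by
        refine (norm_sub_le _ _).trans (add_le_add le_rfl (hle (hint x x.continuous).norm ?_ t))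
        intro s hs
        rw [norm_mul, Real.norm_eq_abs, Real.norm_eq_abs,
          abs_of_nonneg (by linarith [mem_Ici.1 hs] : (0 : ℝ) ≤ s)])
  have hJ : 0 ≤ ∫ t in Ici t₀, t * Q t := by
    refine setIntegral_nonneg measurableSet_Ici fun s hs => mul_nonneg ?_ (hQ0 s)
    linarith [mem_Ici.1 hs]
  have hη0 : 0 ≤ lam * ∫ t in Ici t₀, t * Q t := mul_nonneg hlam hJ
  have hT : ContractingWith ⟨lam * ∫ t in Ici t₀, t * Q t, hη0⟩ T := by
    refine ⟨by exact_mod_cast hη, LipschitzWith.of_dist_le_mul fun x y => ?_⟩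
    refine (BoundedContinuousFunction.dist_le (by positivity)).2 fun t => ?_
    have hx := integrableOn_tail_kernel ht₀ (hcont x x.continuous) (hint x x.continuous)
      (t := max t t₀) (by linarith [le_max_right t t₀])
    have hy := integrableOn_tail_kernel ht₀ (hcont y y.continuous) (hint y y.continuous)
      (t := max t t₀) (by linarith [le_max_right t t₀])
    have heq : T y t - T x t =
        ∫ s in Ici t₀, max (s - max t t₀) 0 * (Q s * (φ (x s) - φ (y s))) := by
      change (c - _) - (c - _) = _
      rw [sub_sub_sub_cancel_left, ← integral_sub hx hy]
      congr 1
      ext s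
      ring
    rw [dist_comm, Real.dist_eq, heq]
    refine (hle (hi.mul_const (lam * dist x y)) (fun s hs => ?_) t).trans (le_of_eq ?_)
    · have hs' : 0 ≤ s := by linarith [mem_Ici.1 hs]
      rw [abs_mul, abs_of_nonneg (hQ0 s), ← mul_assoc]
      refine mul_le_mul_of_nonneg_left ((hφL _ _).trans ?_) (mul_nonneg hs' (hQ0 s))
      rw [← Real.dist_eq]
      exact mul_le_mul_of_nonneg_left (BoundedContinuousFunction.dist_coe_le_dist s) hlam
    · rw [integral_mul_const]
      change _ = (lam * ∫ t in Ici t₀, t * Q t) * dist x y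
      ring
  refine ⟨hT.fixedPoint, (hT.fixedPoint).continuous, fun t => ?_⟩
  exact (DFunLike.congr_fun hT.fixedPoint_isFixedPt t).symm

/-- The tail double integral of `g` solves `x'' = -g`, tends to `c`, and `t x'(t)` vanishes at
infinity. -/
lemma exists_hasDerivAt_tail_integral {t₀ : ℝ} (c : ℝ) (ht₀ : 1 ≤ t₀) {g : ℝ → ℝ}
    (hg : Continuous g) (hg0 : ∀ t, 0 ≤ g t)
    (hi : IntegrableOn (fun s => s * g s) (Ici t₀)) :
    ∃ x x' : ℝ → ℝ, (∀ t, HasDerivAt x (x' t) t ∧ HasDerivAt x' (-g t) t) ∧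
      (∀ t ∈ Ici t₀, x t = c - ∫ s in Ici t₀, max (s - max t t₀) 0 * g s) ∧
      Tendsto x atTop (𝓝 c) ∧ x' =o[atTop] fun t : ℝ => t⁻¹ := by
  have hgi := integrableOn_of_weighted ht₀ hg hi
  have hsg : Continuous fun s => s * g s := by fun_prop
  set A : ℝ → ℝ := fun t => (∫ s in Ioi t₀, g s) - ∫ s in t₀..t, g s with hA
  set B : ℝ → ℝ := fun t => (∫ s in Ioi t₀, s * g s) - ∫ s in t₀..t, s * g s with hB
  have hgi' := hgi.mono_set Ioi_subset_Ici_self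
  have hi' := hi.mono_set Ioi_subset_Ici_self
  have hdA : ∀ t, HasDerivAt A (-g t) t := fun t => by
    simpa using (hg.integral_hasStrictDerivAt t₀ t).hasDerivAt.const_sub (∫ s in Ioi t₀, g s)
  have hdB : ∀ t, HasDerivAt B (-(t * g t)) t := fun t => by
    simpa using
      (hsg.integral_hasStrictDerivAt t₀ t).hasDerivAt.const_sub (∫ s in Ioi t₀, s * g s)
  have hAt : ∀ t ∈ Ici t₀, A t = ∫ s in Ioi t, g s := fun t ht => by
    rw [hA]
    dsimp only
    rw [← intervalIntegral.integral_interval_add_Ioi hgi' (hgi'.mono_set (Ioi_subset_Ioi ht))]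
    ring
  have hBt : ∀ t ∈ Ici t₀, B t = ∫ s in Ioi t, s * g s := fun t ht => by
    rw [hB]
    dsimp only
    rw [← intervalIntegral.integral_interval_add_Ioi hi' (hi'.mono_set (Ioi_subset_Ioi ht))]
    ring
  have hBlim : Tendsto B atTop (𝓝 0) := by
    simpa using (tendsto_const_nhds (x := ∫ s in Ioi t₀, s * g s)).sub
      (intervalIntegral_tendsto_integral_Ioi t₀ hi' tendsto_id)
  have htA0 : ∀ t ∈ Ici t₀, 0 ≤ t * A t := fun t ht => by
    have : 0 ≤ t := by linarith [mem_Ici.1 ht]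
    rw [hAt t ht]
    exact mul_nonneg this (setIntegral_nonneg measurableSet_Ioi fun s _ => hg0 s)
  have htAB : ∀ t ∈ Ici t₀, t * A t ≤ B t := fun t ht => by
    rw [hAt t ht, hBt t ht, ← integral_const_mul]
    refine setIntegral_mono_on ((hgi'.mono_set (Ioi_subset_Ioi ht)).const_mul t)
      (hi'.mono_set (Ioi_subset_Ioi ht)) measurableSet_Ioi fun s hs => ?_
    exact mul_le_mul_of_nonneg_right (le_of_lt hs) (hg0 s)
  have htAlim : Tendsto (fun t => t * A t) atTop (𝓝 0) :=
    tendsto_of_tendsto_of_tendsto_of_le_of_le' tendsto_const_nhds hBlim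
      ((eventually_ge_atTop t₀).mono htA0) ((eventually_ge_atTop t₀).mono htAB)
  refine ⟨fun t => c - B t + t * A t, A, fun t => ⟨?_, hdA t⟩, fun t ht => ?_, ?_, ?_⟩
  · refine (((hdB t).const_sub c).add ((hasDerivAt_id' t).mul (hdA t))).congr_deriv ?_
    ring
  · have hker : ∫ s in Ici t₀, max (s - max t t₀) 0 * g s = ∫ s in Ioi t, (s - t) * g s := by
      rw [max_eq_left (mem_Ici.1 ht)]
      have hsub : Ioi t ⊆ Ici t₀ := fun s hs => (mem_Ici.1 ht).trans (le_of_lt hs)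
      rw [setIntegral_eq_of_subset_of_forall_sdiff_eq_zero measurableSet_Ici hsub]
      · refine setIntegral_congr_fun measurableSet_Ioi fun s hs => ?_
        have : 0 ≤ s - t := sub_nonneg.2 (le_of_lt hs)
        simp only [max_eq_left this]
      · intro s hs
        have : s - t ≤ 0 := sub_nonpos.2 (not_lt.1 hs.2)
        rw [max_eq_right this, zero_mul]
    have hsplit : ∫ s in Ioi t, (s - t) * g s = B t - t * A t := by
      rw [hAt t ht, hBt t ht, ← integral_const_mul, ← integral_sub
        (hi'.mono_set (Ioi_subset_Ioi ht)) ((hgi'.mono_set (Ioi_subset_Ioi ht)).const_mul t)]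
      simp only [sub_mul]
    rw [hker, hsplit]
    ring
  · simpa using (hBlim.const_sub c).add htAlim
  · refine (isLittleO_iff_tendsto' ?_).2 ?_
    · filter_upwards [eventually_gt_atTop 0] with t ht h
      exact absurd h (inv_ne_zero ht.ne')
    · refine htAlim.congr fun t => ?_
      rw [div_inv_eq_mul, mul_comm]

/-- **Improved Atkinson claim.** If `η = λ·∫_{t₀}^∞ t·q(t) dt < 1`, then there is a `p > 1`
such that for every `c ∈ (0,1]` the Emden-Fowler equation `x'' + q(t)·x^λ = 0` has a
solution on `[t₀,∞)` with `c/p ≤ x(t) ≤ c`, `x(t) = c + o(1)` and `x'(t) = o(t⁻¹)`. -/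
theorem stmt_6 (t₀ lam : ℝ) (ht₀ : 1 ≤ t₀) (hlam : 1 < lam)
    (q : ℝ → ℝ) (hq_cont : ContinuousOn q (Set.Ici t₀))
    (hq_nonneg : ∀ t ∈ Set.Ici t₀, 0 ≤ q t)
    (hq_int : IntegrableOn (fun t => t * q t) (Set.Ici t₀))
    (hη : lam * ∫ t in Set.Ici t₀, t * q t < 1) :
    ∃ p : ℝ, 1 < p ∧ ∀ c : ℝ, c ∈ Set.Ioc (0 : ℝ) 1 →
      ∃ x x' : ℝ → ℝ,
        (∀ t ∈ Set.Ici t₀, HasDerivAt x (x' t) t ∧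
          HasDerivAt x' (-(q t * efPow lam (x t))) t) ∧
        (∀ t ∈ Set.Ici t₀, c / p ≤ x t ∧ x t ≤ c) ∧
        Tendsto x atTop (𝓝 c) ∧
        x' =o[atTop] fun t : ℝ => t⁻¹ := by
  have hlam0 : 0 < lam := by linarith
  set Q : ℝ → ℝ := fun t => q (max t t₀) with hQdef
  have hQ : Continuous Q :=
    hq_cont.comp_continuous (by fun_prop) fun t => mem_Ici.2 (le_max_right t t₀)
  have hQ0 : ∀ t, 0 ≤ Q t := fun t => hq_nonneg _ (mem_Ici.2 (le_max_right t t₀))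
  have hQq : ∀ t ∈ Ici t₀, Q t = q t := fun t ht => by
    simp only [hQdef, max_eq_left (mem_Ici.1 ht)]
  have hcongr : EqOn (fun t => t * q t) (fun t => t * Q t) (Ici t₀) := fun t ht => by
    simp only [hQq t ht]
  have hi : IntegrableOn (fun t => t * Q t) (Ici t₀) :=
    hq_int.congr_fun hcongr measurableSet_Ici
  rw [setIntegral_congr_fun measurableSet_Ici hcongr] at hη
  refine ⟨lam / (lam - 1), (one_lt_div (by linarith)).2 (by linarith), fun c hc => ?_⟩
  have hc0 : 0 < c := hc.1
  obtain ⟨y, hy, hyeq⟩ := exists_fixed_point (c := c) ht₀ hlam0.le hQ hQ0 hi hη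
    (continuous_clampedPow hlam c)
    (fun u => (abs_of_nonneg (clampedPow_nonneg lam c u)).trans_le (clampedPow_le hlam hc u))
    (abs_clampedPow_sub_le hlam hc)
  set g : ℝ → ℝ := fun s => Q s * clampedPow lam c (y s) with hgdef
  have hg : Continuous g := hQ.mul ((continuous_clampedPow hlam c).comp hy)
  have hg0 : ∀ t, 0 ≤ g t := fun t => mul_nonneg (hQ0 t) (clampedPow_nonneg _ _ _)
  have hgle : ∀ s ∈ Ici t₀, s * g s ≤ s * Q s * c := fun s hs => by
    have hs' : 0 ≤ s := by linarith [mem_Ici.1 hs]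
    rw [hgdef, ← mul_assoc]
    exact mul_le_mul_of_nonneg_left (clampedPow_le hlam hc _) (mul_nonneg hs' (hQ0 s))
  have hgi : IntegrableOn (fun s => s * g s) (Ici t₀) := by
    refine Integrable.mono' (hi.mul_const c) (by fun_prop) ?_
    refine (ae_restrict_iff' measurableSet_Ici).2 (Eventually.of_forall fun s hs => ?_)
    have hs' : 0 ≤ s := by linarith [mem_Ici.1 hs]
    rw [Real.norm_eq_abs, abs_of_nonneg (mul_nonneg hs' (hg0 s))]
    exact hgle s hs
  obtain ⟨x, x', hder, hxeq, hlim, hlittle⟩ := exists_hasDerivAt_tail_integral c ht₀ hg hg0 hgi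
  have hxy : ∀ t ∈ Ici t₀, x t = y t := fun t ht => (hxeq t ht).trans (hyeq t).symm
  have hbound : ∀ t ∈ Ici t₀, c / (lam / (lam - 1)) ≤ x t ∧ x t ≤ c := fun t ht => by
    have ht0 : 0 ≤ max t t₀ := by linarith [le_max_right t t₀]
    have hnonneg : 0 ≤ ∫ s in Ici t₀, max (s - max t t₀) 0 * g s :=
      integral_nonneg fun s => mul_nonneg (le_max_right _ _) (hg0 s)
    have hle : ∫ s in Ici t₀, max (s - max t t₀) 0 * g s ≤ (∫ s in Ici t₀, s * Q s) * c := by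
      rw [← integral_mul_const]
      refine setIntegral_mono_on (integrableOn_tail_kernel ht₀ hg hgi ht0) (hi.mul_const c)
        measurableSet_Ici fun s hs => ?_
      have hs' : 0 ≤ s := by linarith [mem_Ici.1 hs]
      exact (mul_le_mul_of_nonneg_right (max_le (by linarith) hs') (hg0 s)).trans (hgle s hs)
    rw [hxeq t ht]
    refine ⟨?_, by linarith⟩
    rw [div_div_eq_mul_div, div_le_iff₀ hlam0]
    nlinarith
  refine ⟨x, x', fun t ht => ⟨(hder t).1, ?_⟩, hbound, hlim, hlittle⟩
  have hpos : 0 < x t :=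
    lt_of_lt_of_le (div_pos hc0 (div_pos hlam0 (by linarith))) (hbound t ht).1
  have hgt : g t = q t * efPow lam (x t) := by
    rw [← clampedPow_eq_efPow hpos (hbound t ht).2, hxy t ht, ← hQq t ht]
  rw [← hgt]
  exact (hder t).2
end

section
/- Let M ∈ ℝ, t₀ ≥ 0, and let α, β : [t₀,∞) → ℝ be continuous, absolutely integrable over [t₀,∞), with α(t) ≤ β(t) for all t ≥ t₀ and lim_{t→∞} α(t) = lim_{t→∞} β(t) = 0. Let f : [t₀,∞) × ℝ² → ℝ be continuous and suppose α(t) ≤ ∫_t^∞ f(s, u(s), v(s)) ds ≤ β(t) for all t ≥ t₀, all u ∈ C_M and all v ∈ D. Suppose further that |f(t,u₂(t),v₂(t)) − f(t,u₁(t),v₁(t))| ≤ k₁(t)·|u₂(t) − u₁(t)| + k₂(t)·|v₂(t) − v₁(t)| for all u₁,u₂ ∈ C_M, v₁,v₂ ∈ D and t ≥ t₀, where k₁, k₂ : [t₀,∞) → [0,∞) are continuous and there exists ζ > 0 with χ := ζ·∫_{t₀}^∞ k₁(t) dt + ∫_{t₀}^∞ (t−t₀)·k₁(t) dt + ∫_{t₀}^∞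 k₂(t) dt + (1/ζ)·∫_{t₀}^∞ (t−t₀)·k₂(t) dt < 1. Then the boundary value problem x''(t) + f(t, x(t), x'(t)) = 0 on [t₀,∞), lim_{t→∞} x(t) = M, and α(t) ≤ x'(t) ≤ β(t) for all t ≥ t₀, has exactly one solution. -/
open Real MeasureTheory Filter Topology Set Asymptotics

/-- Membership in `C_M`: continuous with `M - ∫_t^∞ β ≤ u(t) ≤ M - ∫_t^∞ α` on `[t₀,∞)`. -/
def memCM (t₀ M : ℝ) (α β : ℝ → ℝ) (u : ℝ → ℝ) : Prop :=
  ContinuousOn u (Set.Ici t₀) ∧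
    ∀ t ∈ Set.Ici t₀,
      M - (∫ s in Set.Ioi t, β s) ≤ u t ∧ u t ≤ M - ∫ s in Set.Ioi t, α s

/-- Membership in `D`: continuous with `α(t) ≤ v(t) ≤ β(t)` on `[t₀,∞)`. -/
def memD (t₀ : ℝ) (α β : ℝ → ℝ) (v : ℝ → ℝ) : Prop :=
  ContinuousOn v (Set.Ici t₀) ∧ ∀ t ∈ Set.Ici t₀, α t ≤ v t ∧ v t ≤ β t

/-- The tail integral of a function continuous and integrable on `[a,∞)` agrees there with a
function that is differentiable (on both sides) at every point of `[a,∞)`. -/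
theorem exists_hasDerivAt_tail_integral_s7 {a : ℝ} {g : ℝ → ℝ} (hg : ContinuousOn g (Ici a))
    (hi : IntegrableOn g (Ici a)) :
    ∃ h : ℝ → ℝ, (∀ t ∈ Ici a, HasDerivAt h (-g t) t) ∧
      (∀ t ∈ Ici a, h t = ∫ s in Ioi t, g s) ∧ Tendsto h atTop (𝓝 0) := by
  have hc : Continuous fun s => g (max s a) :=
    hg.comp_continuous (continuous_id.max continuous_const) fun s => le_max_right s a
  have hi' : IntegrableOn g (Ioi a) := hi.mono_set Ioi_subset_Ici_self
  have heq : ∀ t ∈ Ici a, ∫ s in a..t, g (max s a) = ∫ s in a..t, g s := fun t ht =>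
    intervalIntegral.integral_congr fun s hs => by
      rw [uIcc_of_le ht] at hs
      simp only [max_eq_left hs.1]
  refine ⟨fun t => (∫ s in Ioi a, g s) - ∫ s in a..t, g (max s a), fun t ht => ?_,
    fun t ht => ?_, ?_⟩
  · have := (hc.integral_hasStrictDerivAt a t).hasDerivAt.const_sub (∫ s in Ioi a, g s)
    rwa [max_eq_left ht] at this
  · simp only [heq t ht]
    rw [← intervalIntegral.integral_interval_add_Ioi hi' (hi'.mono_set (Ioi_subset_Ioi ht))]
    ring
  · have := (intervalIntegral_tendsto_integral_Ioi a hi' tendsto_id).const_sub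
      (∫ s in Ioi a, g s)
    rw [sub_self] at this
    refine this.congr' ?_
    filter_upwards [eventually_ge_atTop a] with t ht
    simp only [id, heq t ht]

/-- Fubini for iterated tail integrals: `∫_a^∞ ∫_s^∞ k(r) dr ds = ∫_a^∞ (r - a) k(r) dr`. -/
theorem integral_tail_integral {a : ℝ} {k : ℝ → ℝ} (hk : IntegrableOn k (Ioi a))
    (hk' : IntegrableOn (fun r => (r - a) * k r) (Ioi a)) :
    IntegrableOn (fun s => ∫ r in Ioi s, k r) (Ioi a) ∧
      ∫ s in Ioi a, ∫ r in Ioi s, k r = ∫ r in Ioi a, (r - a) * k r := by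
  set F : ℝ × ℝ → ℝ := {p : ℝ × ℝ | p.1 < p.2}.indicator fun p => k p.2 with hF
  have hmeas : MeasurableSet {p : ℝ × ℝ | p.1 < p.2} :=
    measurableSet_lt measurable_fst measurable_snd
  have hFm : AEStronglyMeasurable F ((volume.restrict (Ioi a)).prod (volume.restrict (Ioi a))) :=
    hk.aestronglyMeasurable.comp_snd.indicator hmeas
  have hF₁ : ∀ r, (fun s => F (s, r)) = (Iio r).indicator fun _ => k r := fun r => by
    ext s; simp [hF, indicator]
  have hF₂ : ∀ s, (fun r => F (s, r)) = (Ioi s).indicator k := fun s => by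
    ext r; simp [hF, indicator]
  have hnorm : ∀ r, (fun s => ‖F (s, r)‖) = (Iio r).indicator fun _ => ‖k r‖ := fun r => by
    ext s; simp only [hF, indicator, mem_ofPred_eq, mem_Iio]; split_ifs <;> simp
  have hconst : ∀ c : ℝ, ∀ r ∈ Ioi a,
      ∫ s in Ioi a, (Iio r).indicator (fun _ => c) s = (r - a) * c := fun c r hr => by
    rw [setIntegral_indicator measurableSet_Iio, Ioi_inter_Iio, setIntegral_const]
    simp [Measure.real, hr.out.le]
  have hFi : Integrable F ((volume.restrict (Ioi a)).prod (volume.restrict (Ioi a))) := by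
    rw [integrable_prod_iff' hFm]
    constructor
    · refine Eventually.of_forall fun r => ?_
      rw [hF₁, integrable_indicator_iff measurableSet_Iio, IntegrableOn,
        Measure.restrict_restrict measurableSet_Iio, Iio_inter_Ioi]
      exact integrableOn_const (by simp)
    · refine (IntegrableOn.congr_fun hk'.norm (fun r hr => ?_) measurableSet_Ioi)
      simp only [hnorm, hconst _ r hr, norm_mul, Real.norm_of_nonneg (sub_nonneg.2 hr.out.le)]
  have hleft : ∀ s ∈ Ioi a, ∫ r in Ioi a, F (s, r) = ∫ r in Ioi s, k r := fun s hs => by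
    rw [hF₂, setIntegral_indicator measurableSet_Ioi, Ioi_inter_Ioi, sup_eq_right.2 hs.out.le]
  have hright : ∀ r ∈ Ioi a, ∫ s in Ioi a, F (s, r) = (r - a) * k r := fun r hr => by
    rw [hF₁, hconst _ r hr]
  refine ⟨IntegrableOn.congr_fun hFi.integral_prod_left hleft measurableSet_Ioi, ?_⟩
  rw [← setIntegral_congr_fun measurableSet_Ioi hleft,
    ← setIntegral_congr_fun measurableSet_Ioi hright]
  exact integral_integral_swap hFi

/-- A map on a uniformly bounded set of functions that is closed under uniform limits on `S` and
contracted by the map in the uniform distance on `S` has a fixed point, unique on `S`. -/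
theorem exists_unique_fixed_on {X E : Type*} [MetricSpace E] [CompleteSpace E] {S : Set X}
    {A : Set (X → E)} {T : (X → E) → X → E} {χ C : ℝ} (hχ : χ < 1) (hχ0 : 0 ≤ χ)
    (hne : A.Nonempty)
    (hclosed : ∀ (F : ℕ → X → E) (g : X → E), (∀ n, F n ∈ A) →
      TendstoUniformlyOn F g atTop S → g ∈ A)
    (hmaps : ∀ z ∈ A, T z ∈ A)
    (hbdd : ∀ z₁ ∈ A, ∀ z₂ ∈ A, ∀ t ∈ S, dist (z₁ t) (z₂ t) ≤ C)
    (hcontr : ∀ z₁ ∈ A, ∀ z₂ ∈ A, ∀ c, (∀ t ∈ S, dist (z₁ t) (z₂ t) ≤ c) →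
      ∀ t ∈ S, dist (T z₁ t) (T z₂ t) ≤ χ * c) :
    ∃ z ∈ A, (∀ t ∈ S, T z t = z t) ∧
      ∀ w ∈ A, (∀ t ∈ S, T w t = w t) → ∀ t ∈ S, w t = z t := by
  obtain ⟨z₀, hz₀⟩ := hne
  have hmem : ∀ z ∈ A, ∀ n : ℕ, T^[n] z ∈ A := fun z hz n => by
    induction n with
    | zero => exact hz
    | succ n ih => rw [Function.iterate_succ_apply']; exact hmaps _ ih
  have hpow : ∀ z₁ ∈ A, ∀ z₂ ∈ A, ∀ n : ℕ, ∀ t ∈ S,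
      dist (T^[n] z₁ t) (T^[n] z₂ t) ≤ C * χ ^ n := fun z₁ h₁ z₂ h₂ n => by
    induction n with
    | zero => simpa using hbdd z₁ h₁ z₂ h₂
    | succ n ih =>
      intro t ht
      rw [Function.iterate_succ_apply', Function.iterate_succ_apply']
      exact (hcontr _ (hmem z₁ h₁ n) _ (hmem z₂ h₂ n) _ ih t ht).trans_eq (by ring)
  have hstep : ∀ t ∈ S, ∀ n : ℕ, dist (T^[n] z₀ t) (T^[n + 1] z₀ t) ≤ C * χ ^ n :=
    fun t ht n => by
      rw [Function.iterate_succ_apply]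
      exact hpow z₀ hz₀ _ (hmaps _ hz₀) n t ht
  have hlim : ∀ t, ∃ y, t ∈ S → Tendsto (fun n => T^[n] z₀ t) atTop (𝓝 y) := fun t => by
    by_cases ht : t ∈ S
    · obtain ⟨y, hy⟩ := cauchySeq_tendsto_of_complete
        (cauchySeq_of_le_geometric χ C hχ (hstep t ht))
      exact ⟨y, fun _ => hy⟩
    · exact ⟨z₀ t, fun h => absurd h ht⟩
  choose z hz using hlim
  have hdist : ∀ n : ℕ, ∀ t ∈ S, dist (T^[n] z₀ t) (z t) ≤ C * χ ^ n / (1 - χ) :=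
    fun n t ht => dist_le_of_le_geometric_of_tendsto χ C hχ (hstep t ht) (hz t ht) n
  have hpow0 : Tendsto (fun n : ℕ => C * χ ^ n) atTop (𝓝 0) := by
    simpa using (tendsto_pow_atTop_nhds_zero_of_lt_one hχ0 hχ).const_mul C
  have hzA : z ∈ A := by
    refine hclosed (fun n => T^[n] z₀) z (hmem z₀ hz₀) (Metric.tendstoUniformlyOn_iff.2 ?_)
    intro ε hε
    have h0 : Tendsto (fun n : ℕ => C * χ ^ n / (1 - χ)) atTop (𝓝 0) := by
      simpa using hpow0.div_const (1 - χ)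
    filter_upwards [h0.eventually_lt_const hε] with n hn t ht
    rw [dist_comm]
    exact (hdist n t ht).trans_lt hn
  have hfix : ∀ t ∈ S, T z t = z t := fun t ht => by
    have h1 : Tendsto (fun n : ℕ => T^[n + 1] z₀ t) atTop (𝓝 (T z t)) := by
      rw [tendsto_iff_dist_tendsto_zero]
      refine squeeze_zero (g := fun n : ℕ => χ * (C * χ ^ n / (1 - χ)))
        (fun _ => dist_nonneg) (fun n => ?_) ?_
      · rw [Function.iterate_succ_apply']
        exact hcontr _ (hmem z₀ hz₀ n) _ hzA _ (hdist n) t ht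
      · simpa using (hpow0.div_const (1 - χ)).const_mul χ
    exact tendsto_nhds_unique h1 ((tendsto_add_atTop_iff_nat 1).2 (hz t ht))
  refine ⟨z, hzA, hfix, fun w hw hwfix t ht => ?_⟩
  have hle : ∀ n : ℕ, ∀ t ∈ S, dist (w t) (z t) ≤ C * χ ^ n := fun n => by
    induction n with
    | zero => simpa using hbdd w hw z hzA
    | succ n ih =>
      intro t ht
      rw [← hwfix t ht, ← hfix t ht]
      exact (hcontr _ hw _ hzA _ ih t ht).trans_eq (by ring)
  exact dist_le_zero.1 (ge_of_tendsto' hpow0 fun n => hle n t ht)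

theorem abs_tail_integral_sub_le {a : ℝ} {g₁ g₂ k : ℝ → ℝ} (h₁ : IntegrableOn g₁ (Ioi a))
    (h₂ : IntegrableOn g₂ (Ioi a)) (hk : IntegrableOn k (Ioi a))
    (hle : ∀ s ∈ Ioi a, |g₁ s - g₂ s| ≤ k s) {t : ℝ} (ht : t ∈ Ici a) :
    |(∫ s in Ioi t, g₁ s) - ∫ s in Ioi t, g₂ s| ≤ ∫ s in Ioi t, k s ∧
      |(∫ s in Ioi t, g₁ s) - ∫ s in Ioi t, g₂ s| ≤ ∫ s in Ioi a, k s := by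
  have hsub : Ioi t ⊆ Ioi a := Ioi_subset_Ioi ht
  have h : |(∫ s in Ioi t, g₁ s) - ∫ s in Ioi t, g₂ s| ≤ ∫ s in Ioi t, k s := by
    rw [← integral_sub (h₁.mono_set hsub) (h₂.mono_set hsub), ← Real.norm_eq_abs]
    exact norm_integral_le_of_norm_le (hk.mono_set hsub)
      ((ae_restrict_iff' measurableSet_Ioi).2 (Eventually.of_forall fun s hs => hle s (hsub hs)))
  refine ⟨h, h.trans (setIntegral_mono_set hk ?_ hsub.eventuallyLE)⟩
  exact (ae_restrict_iff' measurableSet_Ioi).2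
    (Eventually.of_forall fun s hs => (abs_nonneg _).trans (hle s hs))

theorem continuousOn_tail_integral {a : ℝ} {g : ℝ → ℝ} (hg : ContinuousOn g (Ici a))
    (hi : IntegrableOn g (Ici a)) : ContinuousOn (fun t => ∫ s in Ioi t, g s) (Ici a) := by
  obtain ⟨h, hd, heq, -⟩ := exists_hasDerivAt_tail_integral_s7 hg hi
  exact ContinuousOn.congr (fun t ht => (hd t ht).continuousAt.continuousWithinAt)
    fun t ht => (heq t ht).symm

theorem memD.integrableOn {a : ℝ} {α β v : ℝ → ℝ} (hα : IntegrableOn α (Ici a))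
    (hβ : IntegrableOn β (Ici a)) (hv : memD a α β v) : IntegrableOn v (Ici a) :=
  integrable_of_le_of_le (hv.1.aestronglyMeasurable measurableSet_Ici)
    ((ae_restrict_iff' measurableSet_Ici).2 (Eventually.of_forall fun t ht => (hv.2 t ht).1))
    ((ae_restrict_iff' measurableSet_Ici).2 (Eventually.of_forall fun t ht => (hv.2 t ht).2))
    hα hβ

theorem memD.memCM_sub_tail_integral {a M : ℝ} {α β v : ℝ → ℝ} (hα : IntegrableOn α (Ici a))
    (hβ : IntegrableOn β (Ici a)) (hv : memD a α β v) :
    memCM a M α β fun t => M - ∫ s in Ioi t, v s := by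
  have hi := hv.integrableOn hα hβ
  refine ⟨continuousOn_const.sub (continuousOn_tail_integral hv.1 hi), fun t ht => ?_⟩
  have hsub : Ioi t ⊆ Ici a := Ioi_subset_Ici ht
  exact ⟨sub_le_sub_left (setIntegral_mono_on (hi.mono_set hsub) (hβ.mono_set hsub)
      measurableSet_Ioi fun s hs => (hv.2 s (hsub hs)).2) M,
    sub_le_sub_left (setIntegral_mono_on (hα.mono_set hsub) (hi.mono_set hsub)
      measurableSet_Ioi fun s hs => (hv.2 s (hsub hs)).1) M⟩

theorem exists_forall_le_of_tendsto_zero {a : ℝ} {g : ℝ → ℝ} (hg : ContinuousOn g (Ici a))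
    (h0 : Tendsto g atTop (𝓝 0)) : ∃ C, ∀ t ∈ Ici a, g t ≤ C := by
  obtain ⟨N, hN⟩ := eventually_atTop.1 (h0.eventually_lt_const one_pos)
  obtain ⟨C, hC⟩ := isCompact_Icc.exists_bound_of_continuousOn
    (hg.mono (Icc_subset_Ici_self : Icc a N ⊆ Ici a))
  refine ⟨max C 1, fun t ht => ?_⟩
  rcases le_total t N with h | h
  · exact ((le_abs_self _).trans (hC t ⟨ht, h⟩)).trans (le_max_left _ _)
  · exact (hN t h).le.trans (le_max_right _ _)

/-- Under the stated integral sandwich and Lipschitz conditions with contraction constant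
`χ < 1`, the boundary value problem `x'' + f(t,x,x') = 0`, `x(t) → M`,
`α(t) ≤ x'(t) ≤ β(t)`, has exactly one solution. -/
theorem stmt_7 (M t₀ : ℝ) (ht₀ : 0 ≤ t₀) (α β : ℝ → ℝ)
    (hα_cont : ContinuousOn α (Set.Ici t₀)) (hβ_cont : ContinuousOn β (Set.Ici t₀))
    (hα_int : IntegrableOn α (Set.Ici t₀)) (hβ_int : IntegrableOn β (Set.Ici t₀))
    (hαβ : ∀ t ∈ Set.Ici t₀, α t ≤ β t)
    (hα0 : Tendsto α atTop (𝓝 0)) (hβ0 : Tendsto β atTop (𝓝 0))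
    (f : ℝ → ℝ → ℝ → ℝ)
    (hf_cont : ContinuousOn (fun p : ℝ × ℝ × ℝ => f p.1 p.2.1 p.2.2)
      (Set.Ici t₀ ×ˢ (Set.univ : Set (ℝ × ℝ))))
    (hcond : ∀ u v : ℝ → ℝ, memCM t₀ M α β u → memD t₀ α β v →
      IntegrableOn (fun s => f s (u s) (v s)) (Set.Ici t₀) ∧
      ∀ t ∈ Set.Ici t₀, α t ≤ (∫ s in Set.Ioi t, f s (u s) (v s)) ∧
        (∫ s in Set.Ioi t, f s (u s) (v s)) ≤ β t)
    (k₁ k₂ : ℝ → ℝ)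
    (hk₁_cont : ContinuousOn k₁ (Set.Ici t₀)) (hk₂_cont : ContinuousOn k₂ (Set.Ici t₀))
    (hk₁_nonneg : ∀ t ∈ Set.Ici t₀, 0 ≤ k₁ t) (hk₂_nonneg : ∀ t ∈ Set.Ici t₀, 0 ≤ k₂ t)
    (hk₁_int : IntegrableOn k₁ (Set.Ici t₀)) (hk₂_int : IntegrableOn k₂ (Set.Ici t₀))
    (hk₁_int' : IntegrableOn (fun t => (t - t₀) * k₁ t) (Set.Ici t₀))
    (hk₂_int' : IntegrableOn (fun t => (t - t₀) * k₂ t) (Set.Ici t₀))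
    (hlip : ∀ u₁ u₂ v₁ v₂ : ℝ → ℝ, memCM t₀ M α β u₁ → memCM t₀ M α β u₂ →
      memD t₀ α β v₁ → memD t₀ α β v₂ → ∀ t ∈ Set.Ici t₀,
      |f t (u₂ t) (v₂ t) - f t (u₁ t) (v₁ t)| ≤
        k₁ t * |u₂ t - u₁ t| + k₂ t * |v₂ t - v₁ t|)
    (ζ : ℝ) (hζ : 0 < ζ)
    (hχ : ζ * (∫ t in Set.Ici t₀, k₁ t) + (∫ t in Set.Ici t₀, (t - t₀) * k₁ t) +
        (∫ t in Set.Ici t₀, k₂ t) + (1 / ζ) * (∫ t in Set.Ici t₀, (t - t₀) * k₂ t) < 1) :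
    ∃ x x' : ℝ → ℝ,
      ((∀ t ∈ Set.Ici t₀,
          HasDerivAt x (x' t) t ∧ HasDerivAt x' (-f t (x t) (x' t)) t) ∧
        Tendsto x atTop (𝓝 M) ∧ ∀ t ∈ Set.Ici t₀, α t ≤ x' t ∧ x' t ≤ β t) ∧
      ∀ y y' : ℝ → ℝ,
        ((∀ t ∈ Set.Ici t₀,
            HasDerivAt y (y' t) t ∧ HasDerivAt y' (-f t (y t) (y' t)) t) ∧
          Tendsto y atTop (𝓝 M) ∧ ∀ t ∈ Set.Ici t₀, α t ≤ y' t ∧ y' t ≤ β t) →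
        ∀ t ∈ Set.Ici t₀, y t = x t := by
  have hα' : IntegrableOn α (Ioi t₀) := hα_int.mono_set Ioi_subset_Ici_self
  have hβ' : IntegrableOn β (Ioi t₀) := hβ_int.mono_set Ioi_subset_Ici_self
  rw [integral_Ici_eq_integral_Ioi, integral_Ici_eq_integral_Ioi, integral_Ici_eq_integral_Ioi,
    integral_Ici_eq_integral_Ioi] at hχ
  replace hk₁_int := hk₁_int.mono_set Ioi_subset_Ici_self
  replace hk₂_int := hk₂_int.mono_set Ioi_subset_Ici_self
  replace hk₁_int' := hk₁_int'.mono_set Ioi_subset_Ici_self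
  replace hk₂_int' := hk₂_int'.mono_set Ioi_subset_Ici_self
  have hK₁ : 0 ≤ ∫ t in Ioi t₀, k₁ t :=
    setIntegral_nonneg measurableSet_Ioi fun t ht => hk₁_nonneg t (Ioi_subset_Ici_self ht)
  have hK₂ : 0 ≤ ∫ t in Ioi t₀, k₂ t :=
    setIntegral_nonneg measurableSet_Ioi fun t ht => hk₂_nonneg t (Ioi_subset_Ici_self ht)
  have hK₁' : 0 ≤ ∫ t in Ioi t₀, (t - t₀) * k₁ t :=
    setIntegral_nonneg measurableSet_Ioi fun t ht =>
      mul_nonneg (sub_nonneg.2 (le_of_lt ht)) (hk₁_nonneg t (Ioi_subset_Ici_self ht))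
  have hK₂' : 0 ≤ ∫ t in Ioi t₀, (t - t₀) * k₂ t :=
    setIntegral_nonneg measurableSet_Ioi fun t ht =>
      mul_nonneg (sub_nonneg.2 (le_of_lt ht)) (hk₂_nonneg t (Ioi_subset_Ici_self ht))
  set K₁ := ∫ t in Ioi t₀, k₁ t
  set K₂ := ∫ t in Ioi t₀, k₂ t
  set K₁' := ∫ t in Ioi t₀, (t - t₀) * k₁ t
  set K₂' := ∫ t in Ioi t₀, (t - t₀) * k₂ t
  have hf_comp : ∀ u v, ContinuousOn u (Ici t₀) → ContinuousOn v (Ici t₀) →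
      ContinuousOn (fun s => f s (u s) (v s)) (Ici t₀) := fun u v hu hv =>
    hf_cont.comp (continuousOn_id.prodMk (hu.prodMk hv)) fun t ht => ⟨ht, mem_univ _⟩
  set F : (ℝ → ℝ × ℝ) → ℝ → ℝ := fun z s => f s (z s).1 ((z s).2 / ζ) with hF
  set G : (ℝ → ℝ × ℝ) → ℝ → ℝ := fun z t => ∫ s in Ioi t, F z s with hG
  -- The second coordinate is `ζ` times the derivative, which turns the weighted distance of the
  -- contraction estimate into the sup distance of `ℝ × ℝ`.
  set T : (ℝ → ℝ × ℝ) → ℝ → ℝ × ℝ := fun z t => (M - ∫ s in Ioi t, G z s, ζ * G z t) with hT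
  set A : Set (ℝ → ℝ × ℝ) :=
    {z | memCM t₀ M α β (fun t => (z t).1) ∧ memD t₀ α β fun t => (z t).2 / ζ}
  have hA_of : ∀ u v, memCM t₀ M α β u → memD t₀ α β v → (fun t => (u t, ζ * v t)) ∈ A :=
    fun u v hu hv => ⟨hu, by simpa only [mul_div_cancel_left₀ _ hζ.ne'] using hv⟩
  have hFc : ∀ z ∈ A, ContinuousOn (F z) (Ici t₀) := fun z hz => hf_comp _ _ hz.1.1 hz.2.1
  have hFi : ∀ z ∈ A, IntegrableOn (F z) (Ici t₀) := fun z hz => (hcond _ _ hz.1 hz.2).1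
  have hGD : ∀ z ∈ A, memD t₀ α β (G z) := fun z hz =>
    ⟨continuousOn_tail_integral (hFc z hz) (hFi z hz), (hcond _ _ hz.1 hz.2).2⟩
  have hGi : ∀ z ∈ A, IntegrableOn (G z) (Ici t₀) := fun z hz =>
    (hGD z hz).integrableOn hα_int hβ_int
  have hne : A.Nonempty := by
    have hαD : memD t₀ α β α := ⟨hα_cont, fun t ht => ⟨le_rfl, hαβ t ht⟩⟩
    exact ⟨_, hA_of _ _ (hαD.memCM_sub_tail_integral hα_int hβ_int) hαD⟩
  have hmaps : ∀ z ∈ A, T z ∈ A := fun z hz =>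
    hA_of _ _ ((hGD z hz).memCM_sub_tail_integral hα_int hβ_int) (hGD z hz)
  have hclosed : ∀ (Z : ℕ → ℝ → ℝ × ℝ) (z : ℝ → ℝ × ℝ), (∀ n, Z n ∈ A) →
      TendstoUniformlyOn Z z atTop (Ici t₀) → z ∈ A := fun Z z hZ hlim => by
    have hc : ContinuousOn z (Ici t₀) := hlim.continuousOn <| Frequently.of_forall fun n =>
      ((hZ n).1.1.prodMk ((hZ n).2.1.mul_const ζ)).congr fun t _ => by
        simp [div_mul_cancel₀ _ hζ.ne']
    refine ⟨⟨hc.fst, fun t ht => ?_⟩, ⟨hc.snd.div_const ζ, fun t ht => ?_⟩⟩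
    · have h := (hlim.tendsto_at ht).fst_nhds
      exact ⟨ge_of_tendsto' h fun n => ((hZ n).1.2 t ht).1,
        le_of_tendsto' h fun n => ((hZ n).1.2 t ht).2⟩
    · have h := (hlim.tendsto_at ht).snd_nhds.div_const ζ
      exact ⟨ge_of_tendsto' h fun n => ((hZ n).2.2 t ht).1,
        le_of_tendsto' h fun n => ((hZ n).2.2 t ht).2⟩
  obtain ⟨B, hB⟩ := exists_forall_le_of_tendsto_zero (g := fun t => β t - α t)
    (hβ_cont.sub hα_cont) (by simpa using hβ0.sub hα0)
  have hbdd : ∀ z₁ ∈ A, ∀ z₂ ∈ A, ∀ t ∈ Ici t₀,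
      dist (z₁ t) (z₂ t) ≤ max (∫ s in Ioi t₀, (β s - α s)) (ζ * B) := by
    intro z₁ h₁ z₂ h₂ t ht
    refine max_le_max ?_ ?_
    · have h := (abs_tail_integral_sub_le hβ' hα' (hβ'.sub hα')
        (fun s hs => (abs_of_nonneg (sub_nonneg.2 (hαβ s (Ioi_subset_Ici_self hs)))).le) ht).2
      have := le_of_abs_le h
      have := h₁.1.2 t ht
      have := h₂.1.2 t ht
      rw [Real.dist_eq, abs_le]
      simp only [Pi.sub_apply] at *
      constructor <;> linarith
    · have hB := hB t ht
      have e₁ := h₁.2.2 t ht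
      have e₂ := h₂.2.2 t ht
      rw [Real.dist_eq, ← mul_div_cancel₀ (z₁ t).2 hζ.ne', ← mul_div_cancel₀ (z₂ t).2 hζ.ne',
        ← mul_sub, abs_mul, abs_of_pos hζ]
      refine mul_le_mul_of_nonneg_left (abs_le.2 ?_) hζ.le
      constructor <;> linarith
  have hcontr : ∀ z₁ ∈ A, ∀ z₂ ∈ A, ∀ c, (∀ t ∈ Ici t₀, dist (z₁ t) (z₂ t) ≤ c) →
      ∀ t ∈ Ici t₀, dist (T z₁ t) (T z₂ t) ≤ (ζ * K₁ + K₁' + K₂ + 1 / ζ * K₂') * c := by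
    intro z₁ h₁ z₂ h₂ c hc t ht
    have hc0 : 0 ≤ c := dist_nonneg.trans (hc t ht)
    set k : ℝ → ℝ := fun s => k₁ s * c + k₂ s * (c / ζ) with hk
    have hki : IntegrableOn k (Ioi t₀) := (hk₁_int.mul_const c).add (hk₂_int.mul_const (c / ζ))
    have hk_eq : (fun r => (r - t₀) * k r) =
        fun r => (r - t₀) * k₁ r * c + (r - t₀) * k₂ r * (c / ζ) := by
      ext r; simp only [hk]; ring
    have hki' : IntegrableOn (fun r => (r - t₀) * k r) (Ioi t₀) := by
      rw [hk_eq]; exact (hk₁_int'.mul_const c).add (hk₂_int'.mul_const (c / ζ))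
    have hk_int : ∫ s in Ioi t₀, k s = K₁ * c + K₂ * (c / ζ) := by
      rw [hk, integral_add (hk₁_int.mul_const c) (hk₂_int.mul_const (c / ζ)),
        integral_mul_const, integral_mul_const]
    have hk_int' : ∫ s in Ioi t₀, (s - t₀) * k s = K₁' * c + K₂' * (c / ζ) := by
      rw [hk_eq, integral_add (hk₁_int'.mul_const c) (hk₂_int'.mul_const (c / ζ)),
        integral_mul_const, integral_mul_const]
    have hFk : ∀ s ∈ Ioi t₀, |F z₁ s - F z₂ s| ≤ k s := fun s hs => by
      have hs' : s ∈ Ici t₀ := Ioi_subset_Ici_self hs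
      have hd := hc s hs'
      rw [Prod.dist_eq, max_le_iff, Real.dist_eq, Real.dist_eq] at hd
      refine (hlip _ _ _ _ h₂.1 h₁.1 h₂.2 h₁.2 s hs').trans (add_le_add ?_ ?_)
      · exact mul_le_mul_of_nonneg_left hd.1 (hk₁_nonneg s hs')
      · rw [← sub_div, abs_div, abs_of_pos hζ]
        exact mul_le_mul_of_nonneg_left (div_le_div_of_nonneg_right hd.2 hζ.le)
          (hk₂_nonneg s hs')
    have hF_tail := fun s (hs : s ∈ Ici t₀) => abs_tail_integral_sub_le
      ((hFi z₁ h₁).mono_set Ioi_subset_Ici_self) ((hFi z₂ h₂).mono_set Ioi_subset_Ici_self)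
      hki hFk hs
    obtain ⟨htail, htail_eq⟩ := integral_tail_integral hki hki'
    have hG_tail := (abs_tail_integral_sub_le
      ((hGi z₁ h₁).mono_set Ioi_subset_Ici_self) ((hGi z₂ h₂).mono_set Ioi_subset_Ici_self)
      htail (fun s hs => (hF_tail s (Ioi_subset_Ici_self hs)).1) ht).2
    rw [htail_eq, hk_int'] at hG_tail
    refine max_le ?_ ?_
    · rw [Real.dist_eq, sub_sub_sub_cancel_left, abs_sub_comm]
      refine hG_tail.trans ?_
      have : 0 ≤ (ζ * K₁ + K₂) * c := by positivity
      calc K₁' * c + K₂' * (c / ζ) ≤ K₁' * c + K₂' * (c / ζ) + (ζ * K₁ + K₂) * c := by linarith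
        _ = _ := by ring
    · rw [Real.dist_eq, ← mul_sub, abs_mul, abs_of_pos hζ]
      have h := (hF_tail t ht).2
      rw [hk_int] at h
      refine (mul_le_mul_of_nonneg_left h hζ.le).trans ?_
      have : 0 ≤ (K₁' + 1 / ζ * K₂') * c := by positivity
      calc ζ * (K₁ * c + K₂ * (c / ζ)) = (ζ * K₁ + K₂) * c := by field_simp
        _ ≤ (ζ * K₁ + K₂) * c + (K₁' + 1 / ζ * K₂') * c := by linarith
        _ = _ := by ring
  obtain ⟨z, hzA, hz, huniq⟩ :=
    exists_unique_fixed_on hχ (by positivity) hne hclosed hmaps hbdd hcontr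
  have hz₁ : ∀ t ∈ Ici t₀, (z t).1 = M - ∫ s in Ioi t, G z s := fun t ht =>
    congrArg Prod.fst (hz t ht).symm
  have hz₂ : ∀ t ∈ Ici t₀, (z t).2 / ζ = G z t := fun t ht => by
    rw [← congrArg Prod.snd (hz t ht)]; exact mul_div_cancel_left₀ _ hζ.ne'
  obtain ⟨x', hx'd, hx', -⟩ := exists_hasDerivAt_tail_integral_s7 (hFc z hzA) (hFi z hzA)
  obtain ⟨x, hxd, hx, hx0⟩ := exists_hasDerivAt_tail_integral_s7 (hGD z hzA).1 (hGi z hzA)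
  have hx_eq : ∀ t ∈ Ici t₀, (z t).1 = M - x t := fun t ht => by rw [hz₁ t ht, hx t ht]
  have hx'_eq : ∀ t ∈ Ici t₀, G z t = x' t := fun t ht => (hx' t ht).symm
  refine ⟨fun t => M - x t, x', ⟨fun t ht => ⟨?_, ?_⟩, ?_, fun t ht => ?_⟩, ?_⟩
  · simpa [hx'_eq t ht] using (hxd t ht).const_sub M
  · beta_reduce
    rw [← hx_eq t ht, ← hx'_eq t ht, ← hz₂ t ht]
    exact hx'd t ht
  · simpa using hx0.const_sub M
  · rw [← hx'_eq t ht]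
    exact (hGD z hzA).2 t ht
  · rintro y y' ⟨hd, hyM, hb⟩ t ht
    have hy'D : memD t₀ α β y' :=
      ⟨fun t ht => (hd t ht).2.continuousAt.continuousWithinAt, hb⟩
    have hy'i := hy'D.integrableOn hα_int hβ_int
    have hy : ∀ t ∈ Ici t₀, y t = M - ∫ s in Ioi t, y' s := fun t ht => by
      rw [integral_Ioi_of_hasDerivAt_of_tendsto'
        (fun s hs => (hd s (mem_Ici.2 (le_trans ht hs))).1)
        (hy'i.mono_set (Ioi_subset_Ici ht)) hyM]
      ring
    have hyC : memCM t₀ M α β y := by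
      have h := hy'D.memCM_sub_tail_integral (M := M) hα_int hβ_int
      exact ⟨h.1.congr hy, fun t ht => by rw [hy t ht]; exact h.2 t ht⟩
    have hy'0 : Tendsto y' atTop (𝓝 0) := tendsto_of_tendsto_of_tendsto_of_le_of_le' hα0 hβ0
      ((eventually_ge_atTop t₀).mono fun t ht => (hb t ht).1)
      ((eventually_ge_atTop t₀).mono fun t ht => (hb t ht).2)
    have hFy : F (fun t => (y t, ζ * y' t)) = fun s => f s (y s) (y' s) := by
      ext s; simp only [hF, mul_div_cancel_left₀ _ hζ.ne']
    have hy' : ∀ t ∈ Ici t₀, G (fun t => (y t, ζ * y' t)) t = y' t := fun t ht => by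
      have h := integral_Ioi_of_hasDerivAt_of_tendsto'
        (fun s hs => (hd s (mem_Ici.2 (le_trans ht hs))).2)
        (((hcond y y' hyC hy'D).1.mono_set (Ioi_subset_Ici ht)).neg) hy'0
      rw [integral_neg] at h
      simp only [hG, hFy]
      linarith
    have hfix : ∀ t ∈ Ici t₀,
        T (fun t => (y t, ζ * y' t)) t = (y t, ζ * y' t) := fun t ht => by
      simp only [hT, hy' t ht, hy t ht]
      rw [setIntegral_congr_fun measurableSet_Ioi fun s hs => hy' s (Ioi_subset_Ici ht hs)]
    beta_reduce
    rw [← hx_eq t ht]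
    exact congrArg Prod.fst (huniq _ (hA_of y y' hyC hy'D) hfix t ht)
end

section
/- Let t₀ ≥ 0, M > 0, let f : [t₀,∞) × ℝ → [0,∞) be continuous, and let g : [t₀,∞) → [0,∞) be continuous, integrable over [t₀,∞), with lim_{t→∞} g(t) = 0 and ∫_{t₀}^∞ g(t) dt ≤ M. Assume ∫_t^∞ f(s,u(s)) ds ≤ g(t) for every u ∈ X_M and t ≥ t₀, and that there is a continuous k : [t₀,∞) → [0,∞) with η := ∫_{t₀}^∞ (t−t₀)·k(t) dt < 1 and |f(t,u₂(t)) − f(t,u₁(t))| ≤ k(t)·|u₂(t) − u₁(t)| for all t ≥ t₀, u₁,u₂ ∈ X_M. Then the equation x''(t) + f(t,x(t)) = 0 has a solution x on [t₀,∞) with lim_{t→∞} x(t) = M and 0 ≤ x'(t) ≤ g(t) for all t ≥ t₀. -/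
open Real MeasureTheory Filter Topology Set Asymptotics

/-- The tail integral `t ↦ ∫_t^∞ φ`. -/
noncomputable def tailIntegral (φ : ℝ → ℝ) (t : ℝ) : ℝ := ∫ s in Ioi t, φ s

lemma Continuous.integrableOn_Ioi_of_integrableOn_Ioi {φ : ℝ → ℝ} (hφ : Continuous φ) {a : ℝ}
    (hint : IntegrableOn φ (Ioi a)) (t : ℝ) : IntegrableOn φ (Ioi t) := by
  refine ((hφ.integrableOn_Icc (a := t) (b := a)).union hint).mono_set fun x hx => ?_
  rcases le_or_gt x a with h | h
  · exact Or.inl ⟨le_of_lt hx, h⟩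
  · exact Or.inr h

lemma tailIntegral_eq_sub {φ : ℝ → ℝ} (hφ : Continuous φ) {a : ℝ}
    (hint : IntegrableOn φ (Ioi a)) (t : ℝ) :
    tailIntegral φ t = tailIntegral φ a - ∫ s in a..t, φ s := by
  have h := intervalIntegral.integral_interval_add_Ioi' (μ := volume)
    (hφ.intervalIntegrable a t) (hφ.integrableOn_Ioi_of_integrableOn_Ioi hint t)
  unfold tailIntegral
  linarith

lemma hasDerivAt_tailIntegral {φ : ℝ → ℝ} (hφ : Continuous φ) {a : ℝ}
    (hint : IntegrableOn φ (Ioi a)) (t : ℝ) :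
    HasDerivAt (tailIntegral φ) (-φ t) t := by
  rw [show tailIntegral φ = fun t => tailIntegral φ a - ∫ s in a..t, φ s from
    funext (tailIntegral_eq_sub hφ hint)]
  exact (hφ.integral_hasStrictDerivAt a t).hasDerivAt.const_sub _

lemma continuous_tailIntegral {φ : ℝ → ℝ} (hφ : Continuous φ) {a : ℝ}
    (hint : IntegrableOn φ (Ioi a)) : Continuous (tailIntegral φ) :=
  continuous_iff_continuousAt.2 fun t => (hasDerivAt_tailIntegral hφ hint t).continuousAt

lemma tendsto_tailIntegral {φ : ℝ → ℝ} (hφ : Continuous φ) {a : ℝ}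
    (hint : IntegrableOn φ (Ioi a)) : Tendsto (tailIntegral φ) atTop (𝓝 0) := by
  rw [show tailIntegral φ = fun t => tailIntegral φ a - ∫ s in a..t, φ s from
    funext (tailIntegral_eq_sub hφ hint)]
  simpa [tailIntegral] using
    (intervalIntegral_tendsto_integral_Ioi a hint tendsto_id).const_sub (tailIntegral φ a)

lemma lintegral_tail_eq {φ : ℝ → ENNReal} (hφ : Measurable φ) (a : ℝ) :
    ∫⁻ s in Ioi a, ∫⁻ r in Ioi s, φ r = ∫⁻ r in Ioi a, ENNReal.ofReal (r - a) * φ r := by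
  have hm : Measurable (Function.uncurry fun s r : ℝ => (Ioi s).indicator φ r) := by
    have : (Function.uncurry fun s r : ℝ => (Ioi s).indicator φ r) =
        {p : ℝ × ℝ | p.1 < p.2}.indicator (fun p => φ p.2) := by
      ext ⟨s, r⟩
      simp [indicator]
    rw [this]
    exact (hφ.comp measurable_snd).indicator (measurableSet_lt measurable_fst measurable_snd)
  calc ∫⁻ s in Ioi a, ∫⁻ r in Ioi s, φ r
      = ∫⁻ s in Ioi a, ∫⁻ r, (Ioi s).indicator φ r := by
        simp only [lintegral_indicator measurableSet_Ioi]
    _ = ∫⁻ r, ∫⁻ s in Ioi a, (Ioi s).indicator φ r := lintegral_lintegral_swap hm.aemeasurable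
    _ = ∫⁻ r, (Ioi a).indicator (fun r => ENNReal.ofReal (r - a) * φ r) r := by
        refine lintegral_congr fun r => ?_
        have h1 : (fun s => (Ioi s).indicator φ r) = (Iio r).indicator fun _ => φ r := by
          ext s
          simp [indicator]
        rw [h1, lintegral_indicator measurableSet_Iio, lintegral_const,
          Measure.restrict_restrict measurableSet_Iio, Measure.restrict_apply_univ,
          inter_comm, Ioi_inter_Iio, Real.volume_Ioo, mul_comm]
        by_cases h : a < r
        · simp [h]
        · simp [h, ENNReal.ofReal_of_nonpos (sub_nonpos.2 (not_lt.1 h))]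
    _ = _ := lintegral_indicator measurableSet_Ioi _

lemma integrableOn_tailIntegral {φ : ℝ → ℝ} (hφ : Continuous φ) (h0 : ∀ t, 0 ≤ φ t) {a : ℝ}
    (hint : IntegrableOn φ (Ioi a)) (hw : IntegrableOn (fun r => (r - a) * φ r) (Ioi a)) :
    IntegrableOn (tailIntegral φ) (Ioi a) ∧
      ∫ s in Ioi a, tailIntegral φ s = ∫ r in Ioi a, (r - a) * φ r := by
  have hT0 : ∀ s, 0 ≤ tailIntegral φ s := fun s => integral_nonneg h0
  have hw0 : 0 ≤ᵐ[volume.restrict (Ioi a)] fun r => (r - a) * φ r :=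
    (ae_restrict_iff' measurableSet_Ioi).2 (ae_of_all _ fun r hr =>
      mul_nonneg (sub_nonneg.2 (le_of_lt hr)) (h0 r))
  have hTm := (continuous_tailIntegral hφ hint).aestronglyMeasurable
    (μ := volume.restrict (Ioi a))
  have key : ∫⁻ s in Ioi a, ENNReal.ofReal (tailIntegral φ s) =
      ∫⁻ r in Ioi a, ENNReal.ofReal ((r - a) * φ r) := by
    calc ∫⁻ s in Ioi a, ENNReal.ofReal (tailIntegral φ s)
        = ∫⁻ s in Ioi a, ∫⁻ r in Ioi s, ENNReal.ofReal (φ r) :=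
          lintegral_congr fun s => ofReal_integral_eq_lintegral_ofReal
            (hφ.integrableOn_Ioi_of_integrableOn_Ioi hint s) (ae_of_all _ h0)
      _ = ∫⁻ r in Ioi a, ENNReal.ofReal (r - a) * ENNReal.ofReal (φ r) :=
          lintegral_tail_eq (ENNReal.measurable_ofReal.comp hφ.measurable) a
      _ = _ := lintegral_congr fun r => (ENNReal.ofReal_mul' (h0 r)).symm
  refine ⟨⟨hTm, ?_⟩, ?_⟩
  · rw [hasFiniteIntegral_iff_ofReal (ae_of_all _ hT0), key]
    exact (hasFiniteIntegral_iff_ofReal hw0).1 hw.2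
  · rw [integral_eq_lintegral_of_nonneg_ae (ae_of_all _ hT0) hTm,
      integral_eq_lintegral_of_nonneg_ae hw0 hw.1, key]

lemma integrableOn_Ioi_of_integrableOn_sub_mul_s8 {φ : ℝ → ℝ} (hφ : Continuous φ)
    (h0 : ∀ t, 0 ≤ φ t) {a : ℝ} (hw : IntegrableOn (fun r => (r - a) * φ r) (Ioi a)) :
    IntegrableOn φ (Ioi a) := by
  refine hφ.integrableOn_Ioi_of_integrableOn_Ioi (a := a + 1) ?_ a
  refine Integrable.mono' (hw.mono_set (Ioi_subset_Ioi (by linarith)))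
    hφ.aestronglyMeasurable ((ae_restrict_iff' measurableSet_Ioi).2 (ae_of_all _ fun r hr => ?_))
  have hr' : a + 1 < r := hr
  rw [Real.norm_of_nonneg (h0 r)]
  nlinarith [h0 r]

/-- Banach's fixed point theorem for continuous functions `ℝ → [0, M]` in the sup distance. -/
lemma exists_fixedPoint_of_sup_contraction {M η : ℝ} (hM : 0 ≤ M) (hη0 : 0 ≤ η) (hη : η < 1)
    (T : (ℝ → ℝ) → ℝ → ℝ)
    (hT : ∀ u, Continuous u → (∀ t, u t ∈ Icc 0 M) →
      Continuous (T u) ∧ ∀ t, T u t ∈ Icc 0 M)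
    (hlip : ∀ u v, Continuous u → (∀ t, u t ∈ Icc 0 M) → Continuous v → (∀ t, v t ∈ Icc 0 M) →
      ∀ d, (∀ t, |u t - v t| ≤ d) → ∀ t, |T u t - T v t| ≤ η * d) :
    ∃ u, Continuous u ∧ (∀ t, u t ∈ Icc 0 M) ∧ T u = u := by
  let S : Set (BoundedContinuousFunction ℝ ℝ) := {u | ∀ t, u t ∈ Icc 0 M}
  have hS : IsClosed S := by
    simp only [S, ofPred_forall]
    exact isClosed_iInter fun t => isClosed_Icc.preimage (continuous_eval_const t)
  have : CompleteSpace S := hS.completeSpace_coe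
  have : Nonempty S := ⟨⟨0, fun t => ⟨le_rfl, hM⟩⟩⟩
  let Φ : S → S := fun u =>
    ⟨BoundedContinuousFunction.mkOfBound
      ⟨T u.1, (hT u.1 u.1.continuous u.2).1⟩ M fun s t => by
        have h := (hT u.1 u.1.continuous u.2).2
        simpa using Real.dist_le_of_mem_Icc (h s) (h t),
      (hT u.1 u.1.continuous u.2).2⟩
  have hΦ : ContractingWith ⟨η, hη0⟩ Φ := by
    refine ⟨by exact_mod_cast hη, LipschitzWith.of_dist_le_mul fun u v => ?_⟩
    refine (BoundedContinuousFunction.dist_le (mul_nonneg hη0 dist_nonneg)).2 fun t => ?_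
    exact hlip u.1 v.1 u.1.continuous u.2 v.1.continuous v.2 (dist u.1 v.1)
      (fun s => BoundedContinuousFunction.dist_coe_le_dist (f := u.1) (g := v.1) s) t
  let w := ContractingWith.fixedPoint Φ hΦ
  have hw : Φ w = w := hΦ.fixedPoint_isFixedPt
  refine ⟨w.1, w.1.continuous, w.2, ?_⟩
  exact congrArg (fun z : S => (z.1 : ℝ → ℝ)) hw

/-- If `∫_t^∞ f(s,u(s)) ds ≤ g(t)` for all `u ∈ X_M` with `g → 0`, `∫_{t₀}^∞ g ≤ M`, and
`f` is Lipschitz along `X_M` with `η = ∫ (t-t₀) k(t) dt < 1`, then `x'' + f(t,x) = 0` has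
a solution with `x(t) → M` and `0 ≤ x'(t) ≤ g(t)` on `[t₀,∞)`. -/
theorem stmt_8 (t₀ M : ℝ) (ht₀ : 0 ≤ t₀) (hM : 0 < M)
    (f : ℝ → ℝ → ℝ)
    (hf_cont : ContinuousOn (fun p : ℝ × ℝ => f p.1 p.2) (Set.Ici t₀ ×ˢ Set.univ))
    (hf_nonneg : ∀ t ∈ Set.Ici t₀, ∀ u : ℝ, 0 ≤ f t u)
    (g : ℝ → ℝ) (hg_cont : ContinuousOn g (Set.Ici t₀))
    (hg_nonneg : ∀ t ∈ Set.Ici t₀, 0 ≤ g t)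
    (hg_int : IntegrableOn g (Set.Ici t₀))
    (hg_lim : Tendsto g atTop (𝓝 0))
    (hgM : (∫ t in Set.Ici t₀, g t) ≤ M)
    (hf_int : ∀ u : ℝ → ℝ, memXM t₀ M u →
      IntegrableOn (fun s => f s (u s)) (Set.Ici t₀) ∧
      ∀ t ∈ Set.Ici t₀, (∫ s in Set.Ioi t, f s (u s)) ≤ g t)
    (k : ℝ → ℝ) (hk_cont : ContinuousOn k (Set.Ici t₀))
    (hk_nonneg : ∀ t ∈ Set.Ici t₀, 0 ≤ k t)
    (hk_int : IntegrableOn (fun t => (t - t₀) * k t) (Set.Ici t₀))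
    (hη : (∫ t in Set.Ici t₀, (t - t₀) * k t) < 1)
    (hlip : ∀ u₁ u₂ : ℝ → ℝ, memXM t₀ M u₁ → memXM t₀ M u₂ → ∀ t ∈ Set.Ici t₀,
      |f t (u₂ t) - f t (u₁ t)| ≤ k t * |u₂ t - u₁ t|) :
    ∃ x x' : ℝ → ℝ,
      (∀ t ∈ Set.Ici t₀, HasDerivAt x (x' t) t ∧ HasDerivAt x' (-f t (x t)) t) ∧
      Tendsto x atTop (𝓝 M) ∧
      ∀ t ∈ Set.Ici t₀, 0 ≤ x' t ∧ x' t ≤ g t := by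
  have hmax : ∀ t : ℝ, max t t₀ ∈ Ici t₀ := fun t => le_max_right t t₀
  have hmax_eq : ∀ t ∈ Ici t₀, max t t₀ = t := fun t ht => max_eq_left ht
  have hmaxc : Continuous fun t : ℝ => max t t₀ := continuous_id.max continuous_const
  let F : (ℝ → ℝ) → ℝ → ℝ := fun u s => f (max s t₀) (u (max s t₀))
  let G : (ℝ → ℝ) → ℝ → ℝ := fun u => tailIntegral (F u)
  let H : (ℝ → ℝ) → ℝ → ℝ := fun u => tailIntegral (G u)
  let κ : ℝ → ℝ := fun s => k (max s t₀)
  have hmem : ∀ u : ℝ → ℝ, Continuous u → (∀ t, u t ∈ Icc 0 M) → memXM t₀ M u :=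
    fun u hu h => ⟨hu.continuousOn, fun t _ => h t⟩
  have hF0 : ∀ u t, 0 ≤ F u t := fun u t => hf_nonneg _ (hmax t) _
  have hFeq : ∀ u, ∀ t ∈ Ici t₀, F u t = f t (u t) := fun u t ht => by
    simp only [F, hmax_eq t ht]
  have hFc : ∀ u, Continuous u → Continuous (F u) := fun u hu =>
    hf_cont.comp_continuous (f := fun s => (max s t₀, u (max s t₀)))
      (hmaxc.prodMk (hu.comp hmaxc)) fun s => ⟨hmax s, mem_univ _⟩
  have hFi : ∀ u, Continuous u → (∀ t, u t ∈ Icc 0 M) → IntegrableOn (F u) (Ioi t₀) :=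
    fun u hu h => ((hf_int u (hmem u hu h)).1.congr_fun (fun t ht => (hFeq u t ht).symm)
      measurableSet_Ici).mono_set Ioi_subset_Ici_self
  have hG0 : ∀ u t, 0 ≤ G u t := fun u t => integral_nonneg (hF0 u)
  have hGg : ∀ u, Continuous u → (∀ t, u t ∈ Icc 0 M) → ∀ t ∈ Ici t₀, G u t ≤ g t := by
    intro u hu h t ht
    refine le_trans (le_of_eq ?_) ((hf_int u (hmem u hu h)).2 t ht)
    exact setIntegral_congr_fun measurableSet_Ioi fun s hs =>
      hFeq u s (mem_Ici.2 (le_trans ht (le_of_lt hs)))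
  have hGc : ∀ u, Continuous u → (∀ t, u t ∈ Icc 0 M) → Continuous (G u) :=
    fun u hu h => continuous_tailIntegral (hFc u hu) (hFi u hu h)
  have hgi : IntegrableOn g (Ioi t₀) := hg_int.mono_set Ioi_subset_Ici_self
  have hGi : ∀ u, Continuous u → (∀ t, u t ∈ Icc 0 M) → IntegrableOn (G u) (Ioi t₀) := by
    intro u hu h
    refine Integrable.mono' hgi (hGc u hu h).aestronglyMeasurable
      ((ae_restrict_iff' measurableSet_Ioi).2 (ae_of_all _ fun t ht => ?_))
    rw [Real.norm_of_nonneg (hG0 u t)]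
    exact hGg u hu h t (Ioi_subset_Ici_self ht)
  have hHM : ∀ u, Continuous u → (∀ t, u t ∈ Icc 0 M) → ∀ t ∈ Ici t₀, H u t ≤ M := by
    intro u hu h t ht
    calc H u t ≤ ∫ s in Ioi t₀, G u s :=
          setIntegral_mono_set (hGi u hu h) (ae_of_all _ (hG0 u))
            (Ioi_subset_Ioi ht).eventuallyLE
      _ ≤ ∫ s in Ioi t₀, g s := setIntegral_mono_on (hGi u hu h) hgi measurableSet_Ioi
          fun s hs => hGg u hu h s (Ioi_subset_Ici_self hs)
      _ ≤ M := by rwa [← integral_Ici_eq_integral_Ioi]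
  have hκ0 : ∀ t, 0 ≤ κ t := fun t => hk_nonneg _ (hmax t)
  have hκc : Continuous κ := hk_cont.comp_continuous hmaxc hmax
  have hκeq : EqOn (fun t => (t - t₀) * k t) (fun t => (t - t₀) * κ t) (Ioi t₀) := by
    intro t ht
    simp only [κ, hmax_eq t (Ioi_subset_Ici_self ht)]
  have hκw : IntegrableOn (fun t => (t - t₀) * κ t) (Ioi t₀) :=
    (hk_int.mono_set Ioi_subset_Ici_self).congr_fun hκeq measurableSet_Ioi
  have hκi := integrableOn_Ioi_of_integrableOn_sub_mul_s8 hκc hκ0 hκw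
  obtain ⟨hKi, hKeq⟩ := integrableOn_tailIntegral hκc hκ0 hκi hκw
  set η := ∫ t in Ici t₀, (t - t₀) * k t with hηdef
  have hKη : ∫ s in Ioi t₀, tailIntegral κ s = η := by
    rw [hKeq, hηdef, integral_Ici_eq_integral_Ioi]
    exact (setIntegral_congr_fun measurableSet_Ioi hκeq).symm
  have hK0 : ∀ s, 0 ≤ tailIntegral κ s := fun s => integral_nonneg hκ0
  have hη0 : 0 ≤ η := hKη ▸ integral_nonneg hK0
  have hGlip : ∀ u v, Continuous u → (∀ t, u t ∈ Icc 0 M) → Continuous v →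
      (∀ t, v t ∈ Icc 0 M) → ∀ d, (∀ t, |u t - v t| ≤ d) → ∀ s,
      |G u s - G v s| ≤ tailIntegral κ s * d := by
    intro u v hu hu' hv hv' d hd s
    have hi := hκc.integrableOn_Ioi_of_integrableOn_Ioi hκi s
    have e : G u s - G v s = ∫ r in Ioi s, (F u r - F v r) :=
      (integral_sub ((hFc u hu).integrableOn_Ioi_of_integrableOn_Ioi (hFi u hu hu') s)
        ((hFc v hv).integrableOn_Ioi_of_integrableOn_Ioi (hFi v hv hv') s)).symm
    rw [e, tailIntegral, ← integral_mul_const, ← Real.norm_eq_abs]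
    refine norm_integral_le_of_norm_le (hi.mul_const d) (ae_of_all _ fun r => ?_)
    exact (hlip v u (hmem v hv hv') (hmem u hu hu') _ (hmax r)).trans
      (mul_le_mul_of_nonneg_left (hd _) (hκ0 r))
  have hHlip : ∀ u v, Continuous u → (∀ t, u t ∈ Icc 0 M) → Continuous v →
      (∀ t, v t ∈ Icc 0 M) → ∀ d, (∀ t, |u t - v t| ≤ d) → ∀ t ∈ Ici t₀,
      |H u t - H v t| ≤ η * d := by
    intro u v hu hu' hv hv' d hd t ht
    have hd0 : 0 ≤ d := (abs_nonneg _).trans (hd 0)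
    have hsub : Ioi t ⊆ Ioi t₀ := Ioi_subset_Ioi ht
    have e : H u t - H v t = ∫ s in Ioi t, (G u s - G v s) :=
      (integral_sub ((hGi u hu hu').mono_set hsub) ((hGi v hv hv').mono_set hsub)).symm
    rw [e, ← hKη, ← integral_mul_const, ← Real.norm_eq_abs]
    refine (norm_integral_le_of_norm_le ((hKi.mono_set hsub).mul_const d)
      (ae_of_all _ fun s => hGlip u v hu hu' hv hv' d hd s)).trans ?_
    exact setIntegral_mono_set (hKi.mul_const d)
      (ae_of_all _ fun s => mul_nonneg (hK0 s) hd0) hsub.eventuallyLE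
  obtain ⟨u, hu, hu', hfix⟩ := exists_fixedPoint_of_sup_contraction hM.le hη0 hη
    (fun u t => M - H u (max t t₀))
    (fun u hu h => ⟨continuous_const.sub
        ((continuous_tailIntegral (hGc u hu h) (hGi u hu h)).comp hmaxc), fun t =>
      ⟨sub_nonneg.2 (hHM u hu h _ (hmax t)), sub_le_self _ (integral_nonneg (hG0 u))⟩⟩)
    (fun u v hu hu' hv hv' d hd t => by
      rw [sub_sub_sub_cancel_left, abs_sub_comm]
      exact hHlip u v hu hu' hv hv' d hd _ (hmax t))
  refine ⟨fun t => M - H u t, G u, fun t ht => ⟨?_, ?_⟩, ?_, fun t ht =>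
    ⟨hG0 u t, hGg u hu hu' t ht⟩⟩
  · simpa using (hasDerivAt_tailIntegral (hGc u hu hu') (hGi u hu hu') t).const_sub M
  · have hx : M - H u t = u t := by
      have h := congrFun hfix t
      simpa only [hmax_eq t ht] using h
    have h := hasDerivAt_tailIntegral (hFc u hu) (hFi u hu hu') t
    rw [hFeq u t ht] at h
    simpa only [hx] using h
  · simpa using (tendsto_tailIntegral (hGc u hu hu') (hGi u hu hu')).const_sub M
end

section
/- Let t₀ ≥ 1, λ ≥ 1, ν ∈ [0,1), A > 0, and let q : [t₀,∞) → [0,∞) be continuous with c_ν := ∫_{t₀}^∞ t^{λ+ν}·q(t) dt < +∞. Assume λ·c_ν·(A+c_ν)^{λ−1} < 1−ν and ∫_{t₀}^∞ t^λ·q(t) dt < c_ν/(A+c_ν)^λ. Then the Emden–Fowler equation x''(t) + q(t)·x(t)^λ = 0 possesses a solution x on [t₀,∞) of the form x(t) = A·t + ω(t) with ω(t) = o(t^{1−ν}) as t → ∞ and A^λ·∫_{t₀}^t ∫_s^∞ τ^λ·q(τ) dτ ds ≤ ω(t) ≤ (A+c_ν)^λ·∫_{t₀}^t ∫_s^∞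 τ^λ·q(τ) dτ ds for all t ≥ t₀. -/
open Real MeasureTheory Filter Topology Set Asymptotics

/-- Knaster-Tarski fixed point theorem for antitone functions with values in `[a, b]`. -/
theorem exists_antitone_fixedPoint {a b : ℝ} (hab : a ≤ b) (T : (ℝ → ℝ) → ℝ → ℝ)
    (hanti : ∀ y, Antitone y → (∀ s, y s ∈ Set.Icc a b) → Antitone (T y))
    (hmem : ∀ y, Antitone y → (∀ s, y s ∈ Set.Icc a b) → ∀ s, T y s ∈ Set.Icc a b)
    (hmono : ∀ y z, Antitone y → (∀ s, y s ∈ Set.Icc a b) → Antitone z →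
      (∀ s, z s ∈ Set.Icc a b) → y ≤ z → T y ≤ T z) :
    ∃ y, Antitone y ∧ (∀ s, y s ∈ Set.Icc a b) ∧ T y = y := by
  have : Fact (a ≤ b) := ⟨hab⟩
  let toFun : (ℝᵒᵈ →o Set.Icc a b) → ℝ → ℝ := fun f s => f (OrderDual.toDual s)
  have htoFun : ∀ f, Antitone (toFun f) := fun f s t hst =>
    Subtype.coe_le_coe.2 (f.monotone (OrderDual.toDual_le_toDual.2 hst))
  have htoFun' : ∀ f s, toFun f s ∈ Set.Icc a b := fun f s => (f (OrderDual.toDual s)).2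
  let Φ : (ℝᵒᵈ →o Set.Icc a b) →o (ℝᵒᵈ →o Set.Icc a b) :=
    { toFun := fun f =>
        { toFun := fun s =>
            ⟨T (toFun f) (OrderDual.ofDual s), hmem _ (htoFun f) (htoFun' f) _⟩
          monotone' := fun s t hst =>
            Subtype.coe_le_coe.1 (hanti _ (htoFun f) (htoFun' f) (OrderDual.ofDual_le_ofDual.2 hst)) }
      monotone' := fun f g hfg s =>
        Subtype.coe_le_coe.1 (hmono _ _ (htoFun f) (htoFun' f) (htoFun g) (htoFun' g)
          (fun s => Subtype.coe_le_coe.2 (hfg _)) _) }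
  refine ⟨toFun Φ.lfp, htoFun _, htoFun' _, funext fun s => ?_⟩
  exact congrArg (toFun · s) Φ.map_lfp

/-- A nonnegative weight `g` supported in `[t₀, ∞)` for which `τ ^ p * g τ` is integrable also
integrates `x ^ p` for continuous `x` with `0 ≤ x τ ≤ B * τ`. -/
theorem integrable_mul_rpow_of_le {t₀ p B : ℝ} (ht₀ : 0 < t₀) (hp : 0 ≤ p) (hB : 0 ≤ B)
    {g x : ℝ → ℝ} (hg0 : ∀ τ, 0 ≤ g τ) (hgsupp : ∀ τ < t₀, g τ = 0)
    (hgm : AEStronglyMeasurable g) (hgint : Integrable fun τ => g τ * τ ^ p)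
    (hx : Continuous x) (hx0 : ∀ τ, t₀ ≤ τ → 0 ≤ x τ) (hxB : ∀ τ, t₀ ≤ τ → x τ ≤ B * τ) :
    Integrable fun τ => g τ * x τ ^ p := by
  refine (hgint.const_mul (B ^ p)).mono'
    (hgm.mul (hx.rpow_const fun _ => Or.inr hp).aestronglyMeasurable) (Eventually.of_forall ?_)
  intro τ
  rcases lt_or_ge τ t₀ with h | h
  · simp [hgsupp τ h]
  · have h0 := hx0 τ h
    rw [Real.norm_of_nonneg (mul_nonneg (hg0 τ) (Real.rpow_nonneg h0 p))]
    calc g τ * x τ ^ p ≤ g τ * (B * τ) ^ p :=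
          mul_le_mul_of_nonneg_left (Real.rpow_le_rpow h0 (hxB τ h) hp) (hg0 τ)
      _ = B ^ p * (g τ * τ ^ p) := by rw [Real.mul_rpow hB (ht₀.le.trans h)]; ring

/-- Solvability of the integral form of the Emden-Fowler equation between the lines `A * t` and
`B * t`. -/
theorem exists_integral_solution {t₀ p A B : ℝ} (ht₀ : 0 < t₀) (hp : 0 ≤ p) (hA : 0 < A)
    (hAB : A ≤ B) {g : ℝ → ℝ} (hg0 : ∀ τ, 0 ≤ g τ) (hgsupp : ∀ τ < t₀, g τ = 0)
    (hgm : AEStronglyMeasurable g) (hgint : Integrable fun τ => g τ * τ ^ p)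
    (hgB : B ^ p * (∫ τ, g τ * τ ^ p) ≤ B - A) :
    ∃ x : ℝ → ℝ, Continuous x ∧ (∀ t, t₀ ≤ t → A * t ≤ x t) ∧ (∀ t, t₀ ≤ t → x t ≤ B * t) ∧
      ∀ t, x t = A * t + ∫ s in t₀..t, ∫ τ in Set.Ioi s, g τ * x τ ^ p := by
  have hB : 0 ≤ B := hA.le.trans hAB
  let X : (ℝ → ℝ) → ℝ → ℝ := fun y t => A * t₀ + ∫ s in t₀..t, y s
  have hint : ∀ y : ℝ → ℝ, Antitone y → ∀ a b, IntervalIntegrable y volume a b :=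
    fun y hy a b => hy.intervalIntegrable
  have hXc : ∀ y, Antitone y → Continuous (X y) := fun y hy =>
    continuous_const.add (intervalIntegral.continuous_primitive (hint y hy) t₀)
  have hXA : ∀ y, Antitone y → (∀ s, y s ∈ Set.Icc A B) → ∀ t, t₀ ≤ t → A * t ≤ X y t := by
    intro y hy hyI t ht
    have h := intervalIntegral.integral_mono_on ht (intervalIntegrable_const (c := A))
      (hint y hy t₀ t) fun s _ => (hyI s).1
    rw [intervalIntegral.integral_const, smul_eq_mul] at h
    simp only [X]
    linarith
  have hXB : ∀ y, Antitone y → (∀ s, y s ∈ Set.Icc A B) → ∀ t, t₀ ≤ t → X y t ≤ B * t := by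
    intro y hy hyI t ht
    have h := intervalIntegral.integral_mono_on ht (hint y hy t₀ t)
      (intervalIntegrable_const (c := B)) fun s _ => (hyI s).2
    rw [intervalIntegral.integral_const, smul_eq_mul] at h
    have := mul_le_mul_of_nonneg_right hAB ht₀.le
    simp only [X]
    linarith
  have hX0 : ∀ y, Antitone y → (∀ s, y s ∈ Set.Icc A B) → ∀ t, t₀ ≤ t → 0 ≤ X y t :=
    fun y hy hyI t ht => (mul_nonneg hA.le (ht₀.le.trans ht)).trans (hXA y hy hyI t ht)
  have hF : ∀ y, Antitone y → (∀ s, y s ∈ Set.Icc A B) →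
      Integrable fun τ => g τ * X y τ ^ p := fun y hy hyI =>
    integrable_mul_rpow_of_le ht₀ hp hB hg0 hgsupp hgm hgint (hXc y hy) (hX0 y hy hyI)
      (hXB y hy hyI)
  have hF0 : ∀ y, Antitone y → (∀ s, y s ∈ Set.Icc A B) → ∀ τ, 0 ≤ g τ * X y τ ^ p := by
    intro y hy hyI τ
    rcases lt_or_ge τ t₀ with h | h
    · simp [hgsupp τ h]
    · exact mul_nonneg (hg0 τ) (Real.rpow_nonneg (hX0 y hy hyI τ h) p)
  have hfix : ∃ y, Antitone y ∧ (∀ s, y s ∈ Set.Icc A B) ∧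
      (fun s => A + ∫ τ in Set.Ioi s, g τ * X y τ ^ p) = y := by
    refine exists_antitone_fixedPoint hAB
      (fun y s => A + ∫ τ in Set.Ioi s, g τ * X y τ ^ p) ?_ ?_ ?_
    · intro y hy hyI s t hst
      exact add_le_add_right (setIntegral_mono_set (hF y hy hyI).integrableOn
        (Eventually.of_forall (hF0 y hy hyI)) (Set.Ioi_subset_Ioi hst).eventuallyLE) A
    · intro y hy hyI s
      refine ⟨le_add_of_nonneg_right (integral_nonneg (hF0 y hy hyI)), ?_⟩
      have h1 : ∫ τ in Set.Ioi s, g τ * X y τ ^ p ≤ ∫ τ, g τ * X y τ ^ p :=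
        setIntegral_le_integral (hF y hy hyI) (Eventually.of_forall (hF0 y hy hyI))
      have h2 : ∫ τ, g τ * X y τ ^ p ≤ ∫ τ, B ^ p * (g τ * τ ^ p) := by
        refine integral_mono (hF y hy hyI) (hgint.const_mul _) fun τ => ?_
        rcases lt_or_ge τ t₀ with h | h
        · simp [hgsupp τ h]
        · calc g τ * X y τ ^ p ≤ g τ * (B * τ) ^ p := mul_le_mul_of_nonneg_left
                (Real.rpow_le_rpow (hX0 y hy hyI τ h) (hXB y hy hyI τ h) hp) (hg0 τ)
            _ = B ^ p * (g τ * τ ^ p) := by rw [Real.mul_rpow hB (ht₀.le.trans h)]; ring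
      rw [integral_const_mul] at h2
      linarith
    · intro y z hy hyI hz hzI hyz s
      refine add_le_add_right (setIntegral_mono (hF y hy hyI).integrableOn
        (hF z hz hzI).integrableOn fun τ => ?_) A
      rcases lt_or_ge τ t₀ with h | h
      · simp [hgsupp τ h]
      · refine mul_le_mul_of_nonneg_left (Real.rpow_le_rpow (hX0 y hy hyI τ h) ?_ hp) (hg0 τ)
        exact add_le_add_right (intervalIntegral.integral_mono_on h (hint y hy t₀ τ)
          (hint z hz t₀ τ) fun s _ => hyz s) _
  obtain ⟨y, hy, hyI, hTy⟩ := hfix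
  refine ⟨X y, hXc y hy, hXA y hy hyI, hXB y hy hyI, fun t => ?_⟩
  have hTy' : ∀ s, ∫ τ in Set.Ioi s, g τ * X y τ ^ p = y s - A := fun s => by
    rw [← congrFun hTy s]; ring
  simp only [hTy']
  rw [intervalIntegral.integral_sub (hint y hy t₀ t) intervalIntegrable_const,
    intervalIntegral.integral_const, smul_eq_mul]
  simp only [X]
  ring

/-- The tail integral `s ↦ ∫_s^∞ f` of an integrable function is continuous. -/
theorem continuous_integral_Ioi {f : ℝ → ℝ} (hf : Integrable f) :
    Continuous fun s => ∫ τ in Set.Ioi s, f τ := by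
  have h : (fun s => ∫ τ in Set.Ioi s, f τ) =
      fun s => (∫ τ in Set.Ioi 0, f τ) - ∫ τ in (0 : ℝ)..s, f τ := funext fun s => by
    rw [← intervalIntegral.integral_interval_add_Ioi (hf.integrableOn (s := Set.Ioi 0))
      (hf.integrableOn (s := Set.Ioi s))]
    ring
  rw [h]
  exact continuous_const.sub (intervalIntegral.continuous_primitive
    (fun a b => hf.intervalIntegrable) 0)

/-- If `h = o(s ^ (-ν))` with `ν < 1`, then `∫ h = o(t ^ (1 - ν))`. -/
theorem isLittleO_integral_of_isLittleO_rpow {h : ℝ → ℝ} {ν a : ℝ} (hν : ν < 1)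
    (hh : ∀ c d, IntervalIntegrable h volume c d) (ho : h =o[atTop] fun s : ℝ => s ^ (-ν)) :
    (fun t => ∫ s in a..t, h s) =o[atTop] fun t : ℝ => t ^ (1 - ν) := by
  have hν' : 0 < 1 - ν := sub_pos.2 hν
  rw [isLittleO_iff]
  intro ε hε
  have hδ : 0 < ε / 2 * (1 - ν) := by positivity
  obtain ⟨s₁, hs₁⟩ := eventually_atTop.1 (ho.def hδ)
  let s₂ := max s₁ 1
  have hconst : ∀ᶠ t : ℝ in atTop, |∫ s in a..s₂, h s| ≤ ε / 2 * t ^ (1 - ν) :=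
    ((tendsto_rpow_atTop hν').const_mul_atTop (half_pos hε)).eventually_ge_atTop _
  filter_upwards [hconst, eventually_ge_atTop s₂] with t ht hst
  have hs₂ : (0 : ℝ) < s₂ := zero_lt_one.trans_le (le_max_right _ _)
  have htp : 0 < t := hs₂.trans_le hst
  have hbound : |∫ s in s₂..t, h s| ≤ ε / 2 * t ^ (1 - ν) := by
    have h1 : ‖∫ s in s₂..t, h s‖ ≤ ∫ s in s₂..t, ε / 2 * (1 - ν) * s ^ (-ν) := by
      refine intervalIntegral.norm_integral_le_of_norm_le hst (Eventually.of_forall ?_)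
        ((intervalIntegral.intervalIntegrable_rpow' (by linarith)).const_mul _)
      intro s hs
      have hs0 : 0 < s := hs₂.trans hs.1
      have := hs₁ s ((le_max_left _ _).trans hs.1.le)
      rwa [Real.norm_of_nonneg (Real.rpow_nonneg hs0.le _)] at this
    rw [intervalIntegral.integral_const_mul, integral_rpow (Or.inl (by linarith)),
      neg_add_eq_sub] at h1
    have h2 : 0 ≤ s₂ ^ (1 - ν) := Real.rpow_nonneg hs₂.le _
    have h3 : ε / 2 * (1 - ν) * ((t ^ (1 - ν) - s₂ ^ (1 - ν)) / (1 - ν)) =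
        ε / 2 * (t ^ (1 - ν) - s₂ ^ (1 - ν)) := by
      field_simp
    rw [h3, Real.norm_eq_abs] at h1
    nlinarith
  rw [← intervalIntegral.integral_add_adjacent_intervals (hh a s₂) (hh s₂ t),
    Real.norm_of_nonneg (Real.rpow_nonneg htp.le _)]
  calc ‖(∫ s in a..s₂, h s) + ∫ s in s₂..t, h s‖ ≤ _ := norm_add_le _ _
    _ ≤ ε * t ^ (1 - ν) := by rw [Real.norm_eq_abs, Real.norm_eq_abs]; linarith

/-- If `c_ν = ∫_{t₀}^∞ t^{λ+ν} q(t) dt` satisfies `λ c_ν (A+c_ν)^{λ-1} < 1-ν` and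
`∫_{t₀}^∞ t^λ q(t) dt < c_ν/(A+c_ν)^λ`, the Emden-Fowler equation possesses a solution
`x(t) = A·t + ω(t)` with `ω(t) = o(t^{1-ν})` and
`A^λ ∫_{t₀}^t ∫_s^∞ τ^λ q dτ ds ≤ ω(t) ≤ (A+c_ν)^λ ∫_{t₀}^t ∫_s^∞ τ^λ q dτ ds`. -/
theorem stmt_10 (t₀ lam ν A : ℝ) (ht₀ : 1 ≤ t₀) (hlam : 1 ≤ lam)
    (hν0 : 0 ≤ ν) (hν1 : ν < 1) (hA : 0 < A)
    (q : ℝ → ℝ) (hq_cont : ContinuousOn q (Set.Ici t₀))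
    (hq_nonneg : ∀ t ∈ Set.Ici t₀, 0 ≤ q t)
    (hq_int : IntegrableOn (fun t => t ^ (lam + ν) * q t) (Set.Ici t₀))
    (cν : ℝ) (hcν : cν = ∫ t in Set.Ici t₀, t ^ (lam + ν) * q t)
    (h1 : lam * cν * (A + cν) ^ (lam - 1) < 1 - ν)
    (h2 : (∫ t in Set.Ici t₀, t ^ lam * q t) < cν / (A + cν) ^ lam) :
    ∃ x x' : ℝ → ℝ,
      (∀ t ∈ Set.Ici t₀, HasDerivAt x (x' t) t ∧
        HasDerivAt x' (-(q t * efPow lam (x t))) t) ∧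
      ((fun t => x t - A * t) =o[atTop] fun t : ℝ => t ^ (1 - ν)) ∧
      ∀ t ∈ Set.Ici t₀,
        A ^ lam * (∫ s in t₀..t, ∫ τ in Set.Ioi s, τ ^ lam * q τ) ≤ x t - A * t ∧
        x t - A * t ≤ (A + cν) ^ lam * ∫ s in t₀..t, ∫ τ in Set.Ioi s, τ ^ lam * q τ := by
  have ht₀' : 0 < t₀ := zero_lt_one.trans_le ht₀
  have hlam0 : 0 ≤ lam := zero_le_one.trans hlam
  have hc0 : 0 ≤ cν := hcν ▸ setIntegral_nonneg measurableSet_Ici fun t ht =>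
    mul_nonneg (Real.rpow_nonneg (ht₀'.le.trans ht) _) (hq_nonneg t ht)
  set B := A + cν with hBdef
  have hAB : A ≤ B := le_add_of_nonneg_right hc0
  have hB : 0 < B := hA.trans_le hAB
  let g : ℝ → ℝ := (Set.Ici t₀).indicator q
  have hgq : ∀ τ, t₀ ≤ τ → g τ = q τ := fun τ hτ => Set.indicator_of_mem (Set.mem_Ici.2 hτ) q
  have hg0 : ∀ τ, 0 ≤ g τ := fun τ => Set.indicator_nonneg hq_nonneg τ
  have hgsupp : ∀ τ < t₀, g τ = 0 := fun τ hτ =>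
    Set.indicator_of_notMem (by simpa using hτ) q
  have hgm : AEStronglyMeasurable g :=
    (aestronglyMeasurable_indicator_iff measurableSet_Ici).2
      (hq_cont.aestronglyMeasurable measurableSet_Ici)
  have hgind : ∀ r : ℝ, (fun τ => g τ * τ ^ r) =
      (Set.Ici t₀).indicator fun τ => τ ^ r * q τ := fun r => funext fun τ => by
    by_cases hτ : τ ∈ Set.Ici t₀ <;> simp [g, hτ, mul_comm]
  have hgν : Integrable fun τ => g τ * τ ^ (lam + ν) := by
    rw [hgind]
    exact hq_int.integrable_indicator measurableSet_Ici
  have hgint : Integrable fun τ => g τ * τ ^ lam := by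
    refine hgν.mono' (hgm.mul (Real.continuous_rpow_const hlam0).aestronglyMeasurable)
      (Eventually.of_forall fun τ => ?_)
    rcases lt_or_ge τ t₀ with h | h
    · simp [hgsupp τ h]
    · rw [Real.norm_of_nonneg (mul_nonneg (hg0 τ) (Real.rpow_nonneg (ht₀'.le.trans h) _))]
      exact mul_le_mul_of_nonneg_left
        (Real.rpow_le_rpow_of_exponent_le (ht₀.trans h) (by linarith)) (hg0 τ)
  have hgB : B ^ lam * (∫ τ, g τ * τ ^ lam) ≤ B - A := by
    rw [hgind, integral_indicator measurableSet_Ici]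
    have := (lt_div_iff₀ (Real.rpow_pos_of_pos hB lam)).1 h2
    rw [hBdef] at this ⊢
    linarith
  obtain ⟨x, hxc, hxA, hxB, hx⟩ :=
    exists_integral_solution ht₀' hlam0 hA hAB hg0 hgsupp hgm hgint hgB
  have hxpos : ∀ t, t₀ ≤ t → 0 < x t := fun t ht =>
    (mul_pos hA (ht₀'.trans_le ht)).trans_le (hxA t ht)
  have hF : Integrable fun τ => g τ * x τ ^ lam :=
    integrable_mul_rpow_of_le ht₀' hlam0 hB.le hg0 hgsupp hgm hgint hxc
      (fun τ h => (hxpos τ h).le) hxB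
  let F : ℝ → ℝ := fun τ => g τ * x τ ^ lam
  have hFlow : ∀ τ, A ^ lam * (g τ * τ ^ lam) ≤ F τ := by
    intro τ
    rcases lt_or_ge τ t₀ with h | h
    · simp [F, hgsupp τ h]
    · have hτ : 0 ≤ τ := ht₀'.le.trans h
      calc A ^ lam * (g τ * τ ^ lam) = g τ * (A * τ) ^ lam := by
            rw [Real.mul_rpow hA.le hτ]; ring
        _ ≤ F τ := mul_le_mul_of_nonneg_left
            (Real.rpow_le_rpow (mul_nonneg hA.le hτ) (hxA τ h) hlam0) (hg0 τ)
  have hFup : ∀ τ, F τ ≤ B ^ lam * (g τ * τ ^ lam) := by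
    intro τ
    rcases lt_or_ge τ t₀ with h | h
    · simp [F, hgsupp τ h]
    · calc F τ ≤ g τ * (B * τ) ^ lam := mul_le_mul_of_nonneg_left
            (Real.rpow_le_rpow (hxpos τ h).le (hxB τ h) hlam0) (hg0 τ)
        _ = B ^ lam * (g τ * τ ^ lam) := by
            rw [Real.mul_rpow hB.le (ht₀'.le.trans h)]; ring
  have hF0 : ∀ τ, 0 ≤ F τ := fun τ => by
    rcases lt_or_ge τ t₀ with h | h
    · simp [F, hgsupp τ h]
    · exact mul_nonneg (hg0 τ) (Real.rpow_nonneg (hxpos τ h).le _)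
  have htail : Continuous fun s => ∫ τ in Set.Ioi s, F τ := continuous_integral_Ioi hF
  have htailW := continuous_integral_Ioi hgint
  have hω : ∀ t, x t - A * t = ∫ s in t₀..t, ∫ τ in Set.Ioi s, F τ := fun t => by
    conv_lhs => rw [hx t]
    ring
  have hW : ∀ t, t₀ ≤ t → ∫ s in t₀..t, ∫ τ in Set.Ioi s, τ ^ lam * q τ =
      ∫ s in t₀..t, ∫ τ in Set.Ioi s, g τ * τ ^ lam := by
    intro t ht
    refine intervalIntegral.integral_congr fun s hs => ?_
    rw [Set.uIcc_of_le ht] at hs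
    refine setIntegral_congr_fun measurableSet_Ioi fun τ hτ => ?_
    simp only [hgq τ (hs.1.trans (le_of_lt hτ)), mul_comm]
  -- A solution whose derivatives at `t₀` are two-sided: extend `q x ^ lam` continuously.
  let G : ℝ → ℝ := fun t => q (max t t₀) * x (max t t₀) ^ lam
  have hGF : ∀ t, t₀ ≤ t → G t = F t := fun t ht => by simp [G, F, max_eq_left ht, hgq t ht]
  have hmax : Continuous fun t : ℝ => max t t₀ := continuous_id.max continuous_const
  have hGc : Continuous G :=
    (hq_cont.comp_continuous hmax fun t => le_max_right t t₀).mul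
      ((hxc.comp hmax).rpow_const fun _ => Or.inr hlam0)
  let x' : ℝ → ℝ := fun t => A + (∫ τ in Set.Ioi t₀, F τ) - ∫ τ in t₀..t, G τ
  have hx'd : ∀ t, HasDerivAt x' (-G t) t := fun t =>
    (intervalIntegral.integral_hasDerivAt_right (hGc.intervalIntegrable t₀ t)
      (hGc.stronglyMeasurableAtFilter _ _) hGc.continuousAt).const_sub _
  have hx'c : Continuous x' := continuous_iff_continuousAt.2 fun t => (hx'd t).continuousAt
  have hx'tail : ∀ t, t₀ ≤ t → x' t = A + ∫ τ in Set.Ioi t, F τ := by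
    intro t ht
    have h : ∫ τ in t₀..t, G τ = ∫ τ in t₀..t, F τ :=
      intervalIntegral.integral_congr fun s hs => hGF s (by rw [Set.uIcc_of_le ht] at hs; exact hs.1)
    have := intervalIntegral.integral_Ioi_sub_Ioi hF.integrableOn ht
    simp only [x', h]
    simp only [F] at this ⊢
    linarith
  let z : ℝ → ℝ := fun t => A * t₀ + ∫ s in t₀..t, x' s
  have hzx : ∀ t, t₀ ≤ t → z t = x t := by
    intro t ht
    have h : ∫ s in t₀..t, x' s = ∫ s in t₀..t, (A + ∫ τ in Set.Ioi s, F τ) :=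
      intervalIntegral.integral_congr fun s hs =>
        hx'tail s (by rw [Set.uIcc_of_le ht] at hs; exact hs.1)
    rw [intervalIntegral.integral_add intervalIntegrable_const (htail.intervalIntegrable _ _),
      intervalIntegral.integral_const, smul_eq_mul, ← hω t] at h
    simp only [z, h]
    ring
  refine ⟨z, x', fun t ht => ⟨?_, ?_⟩, ?_, fun t ht => ?_⟩
  · exact (intervalIntegral.integral_hasDerivAt_right (hx'c.intervalIntegrable t₀ t)
      (hx'c.stronglyMeasurableAtFilter _ _) hx'c.continuousAt).const_add _
  · have hpos := hxpos t ht
    have : q t * efPow lam (z t) = G t := by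
      rw [hGF t ht, hzx t ht, efPow, abs_of_pos hpos, Real.rpow_sub_one hpos.ne',
        div_mul_cancel₀ _ hpos.ne', ← hgq t ht]
    rw [this]
    exact hx'd t
  · have hz : (fun t => ∫ s in t₀..t, ∫ τ in Set.Ioi s, F τ) =ᶠ[atTop] fun t => z t - A * t := by
      filter_upwards [eventually_ge_atTop t₀] with t ht
      rw [hzx t ht, hω]
    refine IsLittleO.congr' (isLittleO_integral_of_isLittleO_rpow hν1
      (fun c d => htail.intervalIntegrable c d) ?_) hz EventuallyEq.rfl
    have hR : Tendsto (fun s => ∫ τ in Set.Ioi s, g τ * τ ^ (lam + ν)) atTop (𝓝 0) :=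
      tendsto_integral_Ioi_zero tendsto_id
    rw [isLittleO_iff]
    intro ε hε
    have hBl : 0 < B ^ lam := Real.rpow_pos_of_pos hB lam
    filter_upwards [hR.eventually_le_const (div_pos hε hBl), eventually_ge_atTop t₀] with s hRs hs
    have hs0 : 0 < s := ht₀'.trans_le hs
    rw [Real.norm_of_nonneg (integral_nonneg hF0),
      Real.norm_of_nonneg (Real.rpow_nonneg hs0.le _)]
    calc ∫ τ in Set.Ioi s, F τ
        ≤ ∫ τ in Set.Ioi s, B ^ lam * s ^ (-ν) * (g τ * τ ^ (lam + ν)) := by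
          refine setIntegral_mono_on hF.integrableOn (hgν.const_mul _).integrableOn
            measurableSet_Ioi fun τ hτ => (hFup τ).trans ?_
          have hτ0 : 0 < τ := hs0.trans hτ
          have h1 : 1 ≤ s ^ (-ν) * τ ^ ν := by
            rw [Real.rpow_neg hs0.le, ← div_eq_inv_mul, one_le_div (Real.rpow_pos_of_pos hs0 ν)]
            exact Real.rpow_le_rpow hs0.le (le_of_lt hτ) hν0
          have h2 : 0 ≤ B ^ lam * (g τ * τ ^ lam) :=
            mul_nonneg hBl.le (mul_nonneg (hg0 τ) (Real.rpow_nonneg hτ0.le _))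
          calc B ^ lam * (g τ * τ ^ lam)
              ≤ B ^ lam * (g τ * τ ^ lam) * (s ^ (-ν) * τ ^ ν) := le_mul_of_one_le_right h2 h1
            _ = B ^ lam * s ^ (-ν) * (g τ * τ ^ (lam + ν)) := by
                rw [Real.rpow_add hτ0]; ring
      _ = B ^ lam * s ^ (-ν) * ∫ τ in Set.Ioi s, g τ * τ ^ (lam + ν) := integral_const_mul _ _
      _ ≤ B ^ lam * s ^ (-ν) * (ε / B ^ lam) := mul_le_mul_of_nonneg_left hRs
          (mul_nonneg hBl.le (Real.rpow_nonneg hs0.le _))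
      _ = ε * s ^ (-ν) := by field_simp
  · rw [hzx t ht, hω, hW t ht, ← intervalIntegral.integral_const_mul,
      ← intervalIntegral.integral_const_mul]
    simp only [← integral_const_mul]
    constructor
    · refine intervalIntegral.integral_mono_on ht
        ((continuous_integral_Ioi (hgint.const_mul _)).intervalIntegrable _ _)
        (htail.intervalIntegrable _ _) fun s _ => ?_
      exact setIntegral_mono (hgint.const_mul _).integrableOn hF.integrableOn hFlow
    · refine intervalIntegral.integral_mono_on ht (htail.intervalIntegrable _ _)
        ((continuous_integral_Ioi (hgint.const_mul _)).intervalIntegrable _ _) fun s _ => ?_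
      exact setIntegral_mono hF.integrableOn (hgint.const_mul _).integrableOn hFup
end

section
/- Let t₀ ≥ 1, λ ≥ 1, A > 0, ν ∈ [0,1) with (2 − 1/λ)·ν < 1, and let q : [t₀,∞) → [0,∞) be continuous, not identically zero, with c_ν := ∫_{t₀}^∞ t^{λ+ν}·q(t) dt < +∞. If λ·∫_{t₀}^∞ t^{λ+(2−1/λ)ν}·q(t) dt < 1−ν and (A+1)^λ < t₀^ν, then λ·c_ν·(A+c_ν)^{λ−1} < 1−ν and ∫_{t₀}^∞ t^λ·q(t) dt < c_ν/(A+c_ν)^λ. -/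
open Real MeasureTheory Filter Topology Set Asymptotics

/-- A nonnegative continuous function on `[t₀, ∞)` that is not identically zero has positive
integral. -/
lemma setIntegral_Ici_pos_of_continuousOn {t₀ : ℝ} {f : ℝ → ℝ} (hf : ContinuousOn f (Set.Ici t₀))
    (hf_nonneg : ∀ t ∈ Set.Ici t₀, 0 ≤ f t) (hf_ne : ∃ t ∈ Set.Ici t₀, f t ≠ 0)
    (hf_int : IntegrableOn f (Set.Ici t₀)) : 0 < ∫ t in Set.Ici t₀, f t := by
  have hae : 0 ≤ᵐ[volume.restrict (Set.Ici t₀)] f :=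
    (ae_restrict_iff' measurableSet_Ici).2 (ae_of_all _ hf_nonneg)
  refine (integral_nonneg_of_ae hae).lt_of_ne fun h => ?_
  have hz := (integral_eq_zero_iff_of_nonneg_ae hae hf_int).1 h.symm
  obtain ⟨t, ht, hne⟩ := hf_ne
  refine hne (Measure.eqOn_of_ae_eq hz hf continuousOn_const ?_ ht)
  rw [interior_Ici, closure_Ioi]

/-- Raising the power weight by `b - a` raises the weighted integral over `[t₀, ∞)` by a factor
of at least `t₀ ^ (b - a)`. -/
lemma rpow_mul_setIntegral_Ici_le {t₀ a b : ℝ} {q : ℝ → ℝ} (ht₀ : 0 < t₀) (hab : a ≤ b)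
    (hq : ∀ t ∈ Set.Ici t₀, 0 ≤ q t)
    (hq_int : IntegrableOn (fun t => t ^ b * q t) (Set.Ici t₀)) :
    t₀ ^ (b - a) * (∫ t in Set.Ici t₀, t ^ a * q t) ≤ ∫ t in Set.Ici t₀, t ^ b * q t := by
  rw [← integral_const_mul]
  refine integral_mono_of_nonneg ?_ hq_int ?_
  · refine (ae_restrict_iff' measurableSet_Ici).2 (ae_of_all _ fun t ht => ?_)
    have ht' : 0 < t := ht₀.trans_le ht
    have := hq t ht
    simp only [Pi.zero_apply]
    positivity
  · refine (ae_restrict_iff' measurableSet_Ici).2 (ae_of_all _ fun t ht => ?_)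
    have ht' : 0 < t := ht₀.trans_le ht
    have hle : t₀ ^ (b - a) ≤ t ^ (b - a) := rpow_le_rpow ht₀.le ht (by linarith)
    calc t₀ ^ (b - a) * (t ^ a * q t) ≤ t ^ (b - a) * (t ^ a * q t) :=
          mul_le_mul_of_nonneg_right hle (mul_nonneg (by positivity) (hq t ht))
      _ = t ^ b * q t := by rw [← mul_assoc, ← rpow_add ht']; congr 2; ring

/-- If `λ ∫_{t₀}^∞ t^{λ+(2-1/λ)ν} q(t) dt < 1-ν` and `(A+1)^λ < t₀^ν`, then
`λ c_ν (A+c_ν)^{λ-1} < 1-ν` and `∫_{t₀}^∞ t^λ q(t) dt < c_ν/(A+c_ν)^λ`, where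
`c_ν = ∫_{t₀}^∞ t^{λ+ν} q(t) dt`. -/
theorem stmt_11 (t₀ lam ν A : ℝ) (ht₀ : 1 ≤ t₀) (hlam : 1 ≤ lam) (hA : 0 < A)
    (hν0 : 0 ≤ ν) (hν1 : ν < 1) (hν2 : (2 - 1 / lam) * ν < 1)
    (q : ℝ → ℝ) (hq_cont : ContinuousOn q (Set.Ici t₀))
    (hq_nonneg : ∀ t ∈ Set.Ici t₀, 0 ≤ q t)
    (hq_ne : ∃ t ∈ Set.Ici t₀, q t ≠ 0)
    (hq_int : IntegrableOn (fun t => t ^ (lam + ν) * q t) (Set.Ici t₀))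
    (hq_int' : IntegrableOn (fun t => t ^ (lam + (2 - 1 / lam) * ν) * q t) (Set.Ici t₀))
    (cν : ℝ) (hcν : cν = ∫ t in Set.Ici t₀, t ^ (lam + ν) * q t)
    (h1 : lam * (∫ t in Set.Ici t₀, t ^ (lam + (2 - 1 / lam) * ν) * q t) < 1 - ν)
    (h2 : (A + 1) ^ lam < t₀ ^ ν) :
    lam * cν * (A + cν) ^ (lam - 1) < 1 - ν ∧
      (∫ t in Set.Ici t₀, t ^ lam * q t) < cν / (A + cν) ^ lam := by
  have ht : 0 < t₀ := by linarith
  have hlam0 : 0 < lam := by linarith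
  have hp : 0 ≤ (1 - 1 / lam) * ν := by
    refine mul_nonneg ?_ hν0
    rw [sub_nonneg, div_le_one hlam0]
    exact hlam
  have hc_pos : 0 < cν := by
    rw [hcν]
    refine setIntegral_Ici_pos_of_continuousOn ?_ ?_ ?_ hq_int
    · refine ContinuousOn.mul (fun t h => ?_) hq_cont
      exact (continuousAt_rpow_const _ _ (Or.inl (ht.trans_le h).ne')).continuousWithinAt
    · exact fun t h => mul_nonneg (rpow_nonneg (ht.le.trans h) _) (hq_nonneg t h)
    · obtain ⟨t, h, hne⟩ := hq_ne
      exact ⟨t, h, mul_ne_zero (rpow_pos_of_pos (ht.trans_le h) _).ne' hne⟩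
  have hI := rpow_mul_setIntegral_Ici_le (a := lam + ν) ht (by linarith) hq_nonneg hq_int'
  have hJ := rpow_mul_setIntegral_Ici_le (a := lam) ht (by linarith) hq_nonneg hq_int
  rw [← hcν, show lam + (2 - 1 / lam) * ν - (lam + ν) = (1 - 1 / lam) * ν by ring] at hI
  rw [← hcν, add_sub_cancel_left] at hJ
  set I := ∫ t in Set.Ici t₀, t ^ (lam + (2 - 1 / lam) * ν) * q t
  have hcI : cν ≤ I := le_trans (le_mul_of_one_le_left hc_pos.le (one_le_rpow ht₀ hp)) hI
  have hc_lt : cν < 1 := by nlinarith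
  have hpow : (A + cν) ^ (lam - 1) ≤ t₀ ^ ((1 - 1 / lam) * ν) := by
    calc (A + cν) ^ (lam - 1) ≤ (A + 1) ^ (lam - 1) :=
          rpow_le_rpow (by positivity) (by linarith) (by linarith)
      _ = ((A + 1) ^ lam) ^ (1 - 1 / lam) := by
          rw [← rpow_mul (by positivity)]; congr 1; field_simp
      _ ≤ (t₀ ^ ν) ^ (1 - 1 / lam) := by
          refine rpow_le_rpow (by positivity) h2.le ?_
          rw [sub_nonneg, div_le_one hlam0]
          exact hlam
      _ = t₀ ^ ((1 - 1 / lam) * ν) := by rw [← rpow_mul ht.le, mul_comm]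
  constructor
  · calc lam * cν * (A + cν) ^ (lam - 1) ≤ lam * cν * t₀ ^ ((1 - 1 / lam) * ν) := by gcongr
      _ = lam * (t₀ ^ ((1 - 1 / lam) * ν) * cν) := by ring
      _ ≤ lam * I := by gcongr
      _ < 1 - ν := h1
  · have hlt : (A + cν) ^ lam < t₀ ^ ν :=
      (rpow_le_rpow (by positivity) (by linarith) hlam0.le).trans_lt h2
    calc (∫ t in Set.Ici t₀, t ^ lam * q t) ≤ cν / t₀ ^ ν := by
          rw [le_div_iff₀' (by positivity)]
          exact hJ
      _ < cν / (A + cν) ^ lam := div_lt_div_of_pos_left hc_pos (by positivity) hlt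
end

section
/- Let t₀ ≥ 1, a, b ≥ 0, c ∈ (0,1], and let α, β : [t₀,∞) → [0,∞) be bounded continuous functions with α(t) ≤ β(t) for all t ≥ t₀. If lim_{t→∞} t^{1−c}·α(t) = lim_{t→∞} t^{1−c}·β(t) = d for some d ∈ [0,∞), then every u ∈ F_{a,b,c} satisfies u(t) = a·t + (b + d) + o(1) as t → ∞. -/
open Real MeasureTheory Filter Topology Set Asymptotics

/-- Membership in `F_{a,b,c}`: continuous with
`a·t + b + t·∫_t^∞ α(s)/s^{1+c} ds ≤ u(t) ≤ a·t + b + t·∫_t^∞ β(s)/s^{1+c} ds`. -/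
def memF (t₀ a b c : ℝ) (α β : ℝ → ℝ) (u : ℝ → ℝ) : Prop :=
  ContinuousOn u (Set.Ici t₀) ∧
    ∀ t ∈ Set.Ici t₀,
      a * t + b + t * (∫ s in Set.Ioi t, α s / s ^ (1 + c)) ≤ u t ∧
        u t ≤ a * t + b + t * ∫ s in Set.Ioi t, β s / s ^ (1 + c)

/-- If `s² f(s) → d` as `s → ∞`, then `t ∫_t^∞ f(s) ds → d` as `t → ∞`. -/
theorem tendsto_mul_integral_Ioi_of_sq_mul {f : ℝ → ℝ} {t₀ d : ℝ}
    (hf : ContinuousOn f (Set.Ici t₀)) (hlim : Tendsto (fun s => s ^ 2 * f s) atTop (𝓝 d)) :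
    Tendsto (fun t => t * ∫ s in Set.Ioi t, f s) atTop (𝓝 d) := by
  rw [Metric.tendsto_nhds]
  intro ε hε
  obtain ⟨T, hT⟩ := eventually_atTop.1 (Metric.tendsto_nhds.1 hlim (ε / 2) (half_pos hε))
  filter_upwards [eventually_ge_atTop T, eventually_ge_atTop t₀, eventually_gt_atTop 0]
    with t htT ht₀ ht
  have hint : ∀ k : ℝ, IntegrableOn (fun s : ℝ => k * s ^ (-2 : ℝ)) (Set.Ioi t) := fun k =>
    (integrableOn_Ioi_rpow_of_lt (by norm_num) ht).const_mul k
  have hval : ∀ k : ℝ, ∫ s in Set.Ioi t, k * s ^ (-2 : ℝ) = k * t⁻¹ := by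
    intro k
    rw [integral_const_mul, integral_Ioi_rpow_of_lt (by norm_num) ht]
    norm_num [Real.rpow_neg_one]
  have hbound : ∀ s ∈ Set.Ioi t, ‖f s - d * s ^ (-2 : ℝ)‖ ≤ ε / 2 * s ^ (-2 : ℝ) := by
    intro s hs
    have hs0 : 0 < s := ht.trans hs
    have h := (hT s (htT.trans (le_of_lt hs))).le
    have hpow : s ^ (-2 : ℝ) = (s ^ 2)⁻¹ := by
      rw [Real.rpow_neg hs0.le]; norm_num
    have heq : f s - d * s ^ (-2 : ℝ) = (s ^ 2 * f s - d) * s ^ (-2 : ℝ) := by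
      rw [hpow]; field_simp
    rw [heq, norm_mul, Real.norm_of_nonneg (Real.rpow_nonneg hs0.le _)]
    exact mul_le_mul_of_nonneg_right (by rwa [Real.dist_eq] at h) (Real.rpow_nonneg hs0.le _)
  have hae : ∀ᵐ s ∂volume.restrict (Set.Ioi t),
      ‖f s - d * s ^ (-2 : ℝ)‖ ≤ ε / 2 * s ^ (-2 : ℝ) :=
    (ae_restrict_iff' measurableSet_Ioi).2 (Eventually.of_forall hbound)
  have hmeas : AEStronglyMeasurable f (volume.restrict (Set.Ioi t)) :=
    (hf.mono fun s hs => ht₀.trans (le_of_lt hs)).aestronglyMeasurable measurableSet_Ioi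
  have hdiff : IntegrableOn (fun s => f s - d * s ^ (-2 : ℝ)) (Set.Ioi t) :=
    (hint (ε / 2)).mono' (hmeas.sub (hint d).aestronglyMeasurable) hae
  have hfint : IntegrableOn f (Set.Ioi t) := by
    simpa [IntegrableOn, Pi.add_def] using Integrable.add hdiff (hint d)
  have hle := norm_integral_le_of_norm_le (hint (ε / 2)) hae
  rw [integral_sub hfint (hint d), hval, hval, Real.norm_eq_abs] at hle
  have heq : (t * ∫ s in Set.Ioi t, f s) - d = t * ((∫ s in Set.Ioi t, f s) - d * t⁻¹) := by
    field_simp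
  rw [Real.dist_eq, heq, abs_mul, abs_of_pos ht]
  calc t * |(∫ s in Set.Ioi t, f s) - d * t⁻¹| ≤ t * (ε / 2 * t⁻¹) := by gcongr
    _ = ε / 2 := by field_simp
    _ < ε := half_lt_self hε

/-- If `s^{1-c} g(s) → d` as `s → ∞`, then `t ∫_t^∞ g(s) / s^{1+c} ds → d` as `t → ∞`. -/
theorem tendsto_mul_integral_Ioi_div_rpow {g : ℝ → ℝ} {t₀ c d : ℝ} (ht₀ : 0 < t₀)
    (hg : ContinuousOn g (Set.Ici t₀))
    (hlim : Tendsto (fun t : ℝ => t ^ (1 - c) * g t) atTop (𝓝 d)) :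
    Tendsto (fun t => t * ∫ s in Set.Ioi t, g s / s ^ (1 + c)) atTop (𝓝 d) := by
  have hpos : ∀ s ∈ Set.Ici t₀, 0 < s := fun s hs => ht₀.trans_le hs
  refine tendsto_mul_integral_Ioi_of_sq_mul (t₀ := t₀) (hg.div ?_ ?_) (hlim.congr' ?_)
  · exact continuousOn_id.rpow_const fun s hs => Or.inl (hpos s hs).ne'
  · exact fun s hs => (Real.rpow_pos_of_pos (hpos s hs) _).ne'
  · filter_upwards [eventually_gt_atTop 0] with s hs
    have h : s ^ (1 - c) = s ^ 2 / s ^ (1 + c) := by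
      rw [← Real.rpow_natCast, ← Real.rpow_sub hs]
      congr 1
      push_cast
      ring
    rw [h]
    ring

/-- If `t^{1-c}·α(t) → d` and `t^{1-c}·β(t) → d`, then every `u ∈ F_{a,b,c}` has the
asymptotic profile `u(t) = a·t + (b + d) + o(1)` as `t → ∞`. -/
theorem stmt_13 (t₀ a b c d : ℝ) (ht₀ : 1 ≤ t₀) (ha : 0 ≤ a) (hb : 0 ≤ b)
    (hc : c ∈ Set.Ioc (0 : ℝ) 1) (hd : 0 ≤ d)
    (α β : ℝ → ℝ)
    (hα_cont : ContinuousOn α (Set.Ici t₀)) (hβ_cont : ContinuousOn β (Set.Ici t₀))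
    (hα_nonneg : ∀ t ∈ Set.Ici t₀, 0 ≤ α t) (hβ_nonneg : ∀ t ∈ Set.Ici t₀, 0 ≤ β t)
    (hα_bdd : ∃ Cα : ℝ, ∀ t ∈ Set.Ici t₀, α t ≤ Cα)
    (hβ_bdd : ∃ Cβ : ℝ, ∀ t ∈ Set.Ici t₀, β t ≤ Cβ)
    (hαβ : ∀ t ∈ Set.Ici t₀, α t ≤ β t)
    (hα_lim : Tendsto (fun t : ℝ => t ^ (1 - c) * α t) atTop (𝓝 d))
    (hβ_lim : Tendsto (fun t : ℝ => t ^ (1 - c) * β t) atTop (𝓝 d)) :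
    ∀ u : ℝ → ℝ, memF t₀ a b c α β u →
      Tendsto (fun t => u t - (a * t + (b + d))) atTop (𝓝 0) := by
  rintro u ⟨-, hu⟩
  have ht₀' : 0 < t₀ := one_pos.trans_le ht₀
  have hα := (tendsto_mul_integral_Ioi_div_rpow ht₀' hα_cont hα_lim).sub_const d
  have hβ := (tendsto_mul_integral_Ioi_div_rpow ht₀' hβ_cont hβ_lim).sub_const d
  rw [sub_self] at hα hβ
  refine tendsto_of_tendsto_of_tendsto_of_le_of_le' hα hβ ?_ ?_
  · filter_upwards [eventually_ge_atTop t₀] with t ht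
    linarith [(hu t ht).1]
  · filter_upwards [eventually_ge_atTop t₀] with t ht
    linarith [(hu t ht).2]
end

section
/- Let t₀ ≥ 1, λ ≥ 1, a, b ≥ 0, c ∈ (0,1], ε ∈ (0,1), and let q : [t₀,∞) → [0,∞) be continuous with I_c := ∫_{t₀}^∞ t^{λ+c}·q(t) dt < +∞. Assume λ·(a+ε)^{λ−1}·I_c < c and b/t₀ + (a+ε)^λ·I_c/(c·t₀^c) < ε. Then the Emden–Fowler equation x''(t) + q(t)·x(t)^λ = 0 admits a solution x : [t₀,∞) → [b,∞) with x(t) = a·t + O(t^{1−c}) as t → ∞ and a^λ·(1/t)·∫_{t₀}^t s^{λ+1}·q(s) ds ≤ (x(t) − b)/t − x'(t) ≤ (a+ε)^λ·(1/t^c)·∫_{t₀}^t s^{λ+c}·q(s) ds for all t ≥ t₀; in particular (x(t) − b)/t − x'(t) = O(t^{−c}) as t → ∞. -/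
open Real MeasureTheory Filter Topology Set Asymptotics

/-- Hammerstein integral equations with a dominated kernel and a Lipschitz nonlinearity have a
bounded continuous solution, by Banach's fixed point theorem. -/
lemma exists_hammerstein_solution {μ : Measure ℝ} (f : BoundedContinuousFunction ℝ ℝ)
    (K : ℝ → ℝ → ℝ) (B φ : ℝ → ℝ) (L M : ℝ)
    (hKmeas : ∀ t, AEStronglyMeasurable (K t) μ) (hKcont : ∀ r, Continuous fun t => K t r)
    (hKB : ∀ t, ∀ᵐ r ∂μ, |K t r| ≤ B r) (hB : Integrable B μ)
    (hφ : ∀ u v, |φ u - φ v| ≤ L * |u - v|) (hφc : Continuous φ) (hφM : ∀ u, |φ u| ≤ M)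
    (hB0 : 0 ≤ ∫ r, B r ∂μ) (hL0 : 0 ≤ L) (hLB : L * ∫ r, B r ∂μ < 1) :
    ∃ v : ℝ → ℝ, Continuous v ∧ ∀ t, v t = f t + ∫ r, K t r * φ (v r) ∂μ := by
  have hbound : ∀ (v : BoundedContinuousFunction ℝ ℝ) t,
      ∀ᵐ r ∂μ, ‖K t r * φ (v r)‖ ≤ B r * M := fun v t => by
    filter_upwards [hKB t] with r hr
    rw [norm_mul]
    exact mul_le_mul hr (hφM _) (norm_nonneg _) ((abs_nonneg _).trans hr)
  have hmeas : ∀ (v : BoundedContinuousFunction ℝ ℝ) t,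
      AEStronglyMeasurable (fun r => K t r * φ (v r)) μ := fun v t =>
    (hKmeas t).mul (hφc.comp v.continuous).aestronglyMeasurable
  have hint : ∀ (v : BoundedContinuousFunction ℝ ℝ) t,
      Integrable (fun r => K t r * φ (v r)) μ := fun v t =>
    (hB.mul_const M).mono' (hmeas v t) (hbound v t)
  let T : BoundedContinuousFunction ℝ ℝ → BoundedContinuousFunction ℝ ℝ := fun v =>
    f + BoundedContinuousFunction.ofNormedAddCommGroup (fun t => ∫ r, K t r * φ (v r) ∂μ)
      (continuous_of_dominated (hmeas v) (hbound v) (hB.mul_const M)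
        (ae_of_all _ fun r => (hKcont r).mul continuous_const))
      (∫ r, B r * M ∂μ) (fun t => norm_integral_le_of_norm_le (hB.mul_const M) (hbound v t))
  have hT : ∀ v t, T v t = f t + ∫ r, K t r * φ (v r) ∂μ := fun v t => rfl
  have hLB0 : 0 ≤ L * ∫ r, B r ∂μ := mul_nonneg hL0 hB0
  have hLip : ContractingWith (L * ∫ r, B r ∂μ).toNNReal T := by
    refine ⟨Real.toNNReal_lt_one.2 hLB, LipschitzWith.of_dist_le_mul fun u v => ?_⟩
    refine (BoundedContinuousFunction.dist_le (by positivity)).2 fun t => ?_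
    rw [hT, hT, dist_add_left, dist_eq_norm, ← integral_sub (hint u t) (hint v t)]
    have hle : ‖∫ r, (K t r * φ (u r) - K t r * φ (v r)) ∂μ‖ ≤ ∫ r, B r * (L * dist u v) ∂μ := by
      refine norm_integral_le_of_norm_le (hB.mul_const _) ?_
      filter_upwards [hKB t] with r hr
      rw [← mul_sub, norm_mul]
      refine mul_le_mul hr ((hφ _ _).trans ?_) (norm_nonneg _) ((abs_nonneg _).trans hr)
      exact mul_le_mul_of_nonneg_left (BoundedContinuousFunction.dist_coe_le_dist (f := u) (g := v) r) hL0
    refine hle.trans (le_of_eq ?_)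
    rw [integral_mul_const, Real.coe_toNNReal _ hLB0]
    ring
  obtain ⟨v, hv⟩ : ∃ v, T v = v := ⟨_, hLip.fixedPoint_isFixedPt⟩
  exact ⟨v, v.continuous, fun t => by rw [← hT, hv]⟩

lemma abs_rpow_sub_rpow_le {p R u v : ℝ} (hp : 1 ≤ p) (hu : u ∈ Icc 0 R) (hv : v ∈ Icc 0 R) :
    |u ^ p - v ^ p| ≤ p * R ^ (p - 1) * |u - v| := by
  refine Convex.norm_image_sub_le_of_norm_hasDerivWithin_le (s := Icc 0 R)
    (f' := fun x => p * x ^ (p - 1)) (f := fun x : ℝ => x ^ p)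
    (fun x _ => (Real.hasDerivAt_rpow_const (Or.inr hp)).hasDerivWithinAt) ?_
    (convex_Icc 0 R) hv hu
  intro x hx
  have hx0 := hx.1
  rw [Real.norm_of_nonneg (by positivity)]
  gcongr
  exact hx.2

lemma abs_clamp_sub_clamp_le (l m u v : ℝ) :
    |max l (min u m) - max l (min v m)| ≤ |u - v| := by
  refine (abs_max_sub_max_le_max _ _ _ _).trans ?_
  rw [sub_self, abs_zero]
  refine max_le (abs_nonneg _) ((abs_min_sub_min_le_max _ _ _ _).trans ?_)
  rw [sub_self, abs_zero]
  exact max_le le_rfl (abs_nonneg _)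

lemma efPow_of_nonneg {lam x : ℝ} (hlam : 1 ≤ lam) (hx : 0 ≤ x) : efPow lam x = x ^ lam := by
  rcases hx.eq_or_lt with rfl | hx
  · rw [efPow, mul_zero, zero_rpow (by linarith)]
  · rw [efPow, abs_of_pos hx, rpow_sub_one hx.ne', div_mul_cancel₀ _ hx.ne']

lemma min_div_one_le_rpow {r t c : ℝ} (hr : 0 < r) (ht : 0 < t) (hc : c ∈ Ioc (0 : ℝ) 1) :
    min (r / t) 1 ≤ t ^ (-c) * r ^ c := by
  have hrt : 0 < r / t := div_pos hr ht
  have heq : t ^ (-c) * r ^ c = (r / t) ^ c := by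
    rw [div_rpow hr.le ht.le, rpow_neg ht.le]
    field_simp
  rw [heq]
  rcases le_total (r / t) 1 with h | h
  · rw [min_eq_left h]
    simpa using rpow_le_rpow_of_exponent_ge hrt h hc.2
  · rw [min_eq_right h]
    exact one_le_rpow h hc.1.le

lemma integral_Ioi_min_div_one_mul {t₀ t : ℝ} {g : ℝ → ℝ} (ht₀ : 0 < t₀) (ht : t₀ ≤ t)
    (hg : Continuous g) (hgi : IntegrableOn g (Ioi t₀)) :
    t * ∫ r in Ioi t₀, min (r / t) 1 * g r =
      (∫ r in t₀..t, r * g r) + t * ((∫ r in Ioi t₀, g r) - ∫ r in t₀..t, g r) := by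
  have htpos : 0 < t := ht₀.trans_le ht
  have hker : IntegrableOn (fun r => min (r / t) 1 * g r) (Ioi t₀) := by
    refine hgi.norm.mono' (by fun_prop) ?_
    filter_upwards [ae_restrict_mem measurableSet_Ioi] with r hr
    have hr0 : 0 < r := ht₀.trans hr
    rw [norm_mul]
    refine mul_le_of_le_one_left (norm_nonneg _) ?_
    rw [Real.norm_of_nonneg (by positivity)]
    exact min_le_right _ _
  have hgt : IntegrableOn g (Ioi t) := hgi.mono_set (Ioi_subset_Ioi ht)
  have hkt := hker.mono_set (Ioi_subset_Ioi ht)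
  rw [← intervalIntegral.integral_interval_add_Ioi hker hkt,
    ← intervalIntegral.integral_interval_add_Ioi hgi hgt, add_sub_cancel_left, mul_add]
  congr 1
  · rw [← intervalIntegral.integral_const_mul]
    refine intervalIntegral.integral_congr fun r hr => ?_
    rw [uIcc_of_le ht] at hr
    rw [min_eq_left ((div_le_one htpos).2 hr.2)]
    field_simp
  · congr 1
    refine setIntegral_congr_fun measurableSet_Ioi fun r hr => ?_
    rw [min_eq_right ((one_le_div htpos).2 (le_of_lt hr)), one_mul]

/-- The integral equation satisfied by `v = x / t` for a solution `x` of the Emden-Fowler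
equation asymptotic to `a t`. -/
lemma exists_emdenFowler_integral_solution {t₀ lam a b c ε : ℝ} (ht₀ : 1 ≤ t₀) (hlam : 1 ≤ lam)
    (ha : 0 ≤ a) (hb : 0 ≤ b) (hc : c ∈ Ioc (0 : ℝ) 1) (hε : 0 < ε)
    {Q : ℝ → ℝ} (hQ : Continuous Q) (hQ0 : ∀ t, 0 ≤ Q t)
    (hint : IntegrableOn (fun t => t ^ (lam + c) * Q t) (Ioi t₀))
    (h1 : lam * (a + ε) ^ (lam - 1) * (∫ t in Ioi t₀, t ^ (lam + c) * Q t) < c)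
    (h2 : b / t₀ + (a + ε) ^ lam * (∫ t in Ioi t₀, t ^ (lam + c) * Q t) / (c * t₀ ^ c) < ε) :
    ∃ v : ℝ → ℝ, Continuous v ∧ (∀ t, v t ∈ Icc a (a + ε)) ∧ ∀ t ∈ Ici t₀,
      v t = b / t + a + (∫ r in Ioi t₀, min (r / t) 1 * (max r t₀ ^ lam * Q r * v r ^ lam)) ∧
      0 ≤ (∫ r in Ioi t₀, min (r / t) 1 * (max r t₀ ^ lam * Q r * v r ^ lam)) ∧
      (∫ r in Ioi t₀, min (r / t) 1 * (max r t₀ ^ lam * Q r * v r ^ lam)) ≤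
        (a + ε) ^ lam * (∫ t in Ioi t₀, t ^ (lam + c) * Q t) * t ^ (-c) := by
  have hc0 := hc.1
  have hpos : 0 < t₀ := by linarith
  have hlam0 : 0 ≤ lam := by linarith
  set I := ∫ t in Ioi t₀, t ^ (lam + c) * Q t
  have hI0 : 0 ≤ I := setIntegral_nonneg measurableSet_Ioi fun r hr =>
    mul_nonneg (rpow_nonneg (hpos.trans hr).le _) (hQ0 r)
  let cl : ℝ → ℝ := fun u => max a (min u (a + ε))
  have hcl : ∀ u, cl u ∈ Icc a (a + ε) := fun u =>
    ⟨le_max_left _ _, max_le (by linarith) (min_le_right _ _)⟩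
  have hcl0 : ∀ u, cl u ∈ Icc 0 (a + ε) := fun u => ⟨ha.trans (hcl u).1, (hcl u).2⟩
  have hφ0 : ∀ u, 0 ≤ cl u ^ lam := fun u => rpow_nonneg (hcl0 u).1 _
  have hφM : ∀ u, cl u ^ lam ≤ (a + ε) ^ lam := fun u =>
    rpow_le_rpow (hcl0 u).1 (hcl0 u).2 hlam0
  have hclc : Continuous cl := by fun_prop
  have hφc : Continuous fun u => cl u ^ lam := hclc.rpow_const fun _ => Or.inr hlam0
  have hmaxpos : ∀ t, 0 < max t t₀ := fun t => lt_max_of_lt_right hpos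
  have hwc : Continuous fun r : ℝ => max r t₀ ^ lam :=
    (by fun_prop : Continuous fun r : ℝ => max r t₀).rpow_const fun _ => Or.inr hlam0
  let K : ℝ → ℝ → ℝ := fun t r => min (r / max t t₀) 1 * (max r t₀ ^ lam * Q r)
  have hKr : ∀ t, Continuous (K t) := fun t => by fun_prop
  have hKt : ∀ r, Continuous fun t => K t r := fun r => by
    refine Continuous.mul (Continuous.min (Continuous.div continuous_const (by fun_prop)
      fun t => (hmaxpos t).ne') continuous_const) continuous_const
  have hK0 : ∀ t, ∀ r ∈ Ioi t₀, 0 ≤ K t r := fun t r hr => by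
    have hr0 : 0 < r := hpos.trans hr
    exact mul_nonneg (le_min (div_nonneg hr0.le (hmaxpos t).le) zero_le_one)
      (mul_nonneg (rpow_nonneg (hmaxpos r).le _) (hQ0 r))
  have hKle : ∀ t, ∀ r ∈ Ioi t₀, K t r ≤ max t t₀ ^ (-c) * (r ^ (lam + c) * Q r) :=
    fun t r hr => by
      have hr0 : 0 < r := hpos.trans hr
      have hmul := mul_le_mul_of_nonneg_right (min_div_one_le_rpow hr0 (hmaxpos t) hc)
        (mul_nonneg (rpow_nonneg hr0.le lam) (hQ0 r))
      simp only [K]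
      rw [max_eq_left (le_of_lt hr : t₀ ≤ r), rpow_add hr0]
      linarith
  have hsmall : ∀ t, max t t₀ ^ (-c) ≤ 1 := fun t =>
    rpow_le_one_of_one_le_of_nonpos (ht₀.trans (le_max_right _ _)) (by linarith)
  let f : BoundedContinuousFunction ℝ ℝ :=
    BoundedContinuousFunction.ofNormedAddCommGroup (fun t => b / max t t₀ + a)
      ((Continuous.div continuous_const (by fun_prop) fun t => (hmaxpos t).ne').add
        continuous_const) (b / t₀ + a) (fun t => by
        rw [Real.norm_of_nonneg (add_nonneg (div_nonneg hb (hmaxpos t).le) ha)]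
        gcongr
        exact le_max_right _ _)
  obtain ⟨v, hvc, hv⟩ := exists_hammerstein_solution (μ := volume.restrict (Ioi t₀)) f K
    (fun t => t ^ (lam + c) * Q t) (fun u => cl u ^ lam) (lam * (a + ε) ^ (lam - 1))
    ((a + ε) ^ lam) (fun t => (hKr t).aestronglyMeasurable) hKt
    (fun t => by
      filter_upwards [ae_restrict_mem measurableSet_Ioi] with r hr
      rw [abs_of_nonneg (hK0 t r hr)]
      refine (hKle t r hr).trans (mul_le_of_le_one_left ?_ (hsmall t))
      exact mul_nonneg (rpow_nonneg (hpos.trans hr).le _) (hQ0 r))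
    hint
    (fun u w => (abs_rpow_sub_rpow_le hlam (hcl0 u) (hcl0 w)).trans
      (mul_le_mul_of_nonneg_left (abs_clamp_sub_clamp_le _ _ _ _) (by positivity)))
    hφc (fun u => by rw [abs_of_nonneg (hφ0 u)]; exact hφM u) hI0 (by positivity)
    (h1.trans_le hc.2)
  have hJ0 : ∀ t, 0 ≤ ∫ r in Ioi t₀, K t r * cl (v r) ^ lam := fun t =>
    setIntegral_nonneg measurableSet_Ioi fun r hr => mul_nonneg (hK0 t r hr) (hφ0 _)
  have hJle : ∀ t, ∫ r in Ioi t₀, K t r * cl (v r) ^ lam ≤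
      (a + ε) ^ lam * I * max t t₀ ^ (-c) := fun t => by
    have hle : ∫ r in Ioi t₀, K t r * cl (v r) ^ lam ≤
        ∫ r in Ioi t₀, (max t t₀ ^ (-c) * (a + ε) ^ lam) * (r ^ (lam + c) * Q r) := by
      refine integral_mono_of_nonneg ?_ (hint.const_mul _) ?_
      · filter_upwards [ae_restrict_mem measurableSet_Ioi] with r hr
        exact mul_nonneg (hK0 t r hr) (hφ0 _)
      · filter_upwards [ae_restrict_mem measurableSet_Ioi] with r hr
        refine (mul_le_mul (hKle t r hr) (hφM (v r)) (hφ0 _)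
          ((hK0 t r hr).trans (hKle t r hr))).trans (le_of_eq (by ring))
    rw [integral_const_mul] at hle
    linarith
  have hmem : ∀ t, v t ∈ Icc a (a + ε) := fun t => by
    have hft : f t = b / max t t₀ + a := rfl
    have hb1 : b / max t t₀ ≤ b / t₀ := by gcongr; exact le_max_right _ _
    have hb0 : 0 ≤ b / max t t₀ := div_nonneg hb (hmaxpos t).le
    rw [hv t, hft]
    refine ⟨by linarith [hJ0 t], ?_⟩
    have hM : 0 ≤ (a + ε) ^ lam * I := by positivity
    have hle : (a + ε) ^ lam * I * max t t₀ ^ (-c) ≤ (a + ε) ^ lam * I / (c * t₀ ^ c) := by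
      rw [div_eq_mul_inv]
      refine mul_le_mul_of_nonneg_left ?_ hM
      rw [rpow_neg (hmaxpos t).le]
      refine inv_anti₀ (by positivity) ?_
      refine (mul_le_of_le_one_left (by positivity) hc.2).trans ?_
      exact rpow_le_rpow hpos.le (le_max_right _ _) hc0.le
    linarith [hJle t]
  have hclv : ∀ t, cl (v t) = v t := fun t => by
    simp only [cl]
    rw [min_eq_left (hmem t).2, max_eq_right (hmem t).1]
  refine ⟨v, hvc, hmem, fun t ht => ?_⟩
  have hmt : max t t₀ = t := max_eq_left ht
  have hJ : ∫ r in Ioi t₀, K t r * cl (v r) ^ lam =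
      ∫ r in Ioi t₀, min (r / t) 1 * (max r t₀ ^ lam * Q r * v r ^ lam) := by
    simp only [K, hclv, hmt, mul_assoc]
  have hvt := hv t
  have hft : f t = b / max t t₀ + a := rfl
  have h0 := hJ0 t
  have hle := hJle t
  rw [hft] at hvt
  rw [hJ, hmt] at hvt hle
  rw [hJ] at h0
  exact ⟨hvt, h0, hle⟩

/-- With `I_c = ∫_{t₀}^∞ t^{λ+c} q(t) dt`, if `λ(a+ε)^{λ-1} I_c < c` and
`b/t₀ + (a+ε)^λ I_c/(c t₀^c) < ε`, then the Emden-Fowler equation admits a solution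
`x : [t₀,∞) → [b,∞)` with `x(t) = a·t + O(t^{1-c})` and
`a^λ (1/t) ∫_{t₀}^t s^{λ+1} q ds ≤ (x(t)-b)/t - x'(t) ≤ (a+ε)^λ (1/t^c) ∫_{t₀}^t s^{λ+c} q ds`;
in particular `(x(t)-b)/t - x'(t) = O(t^{-c})`. -/
theorem stmt_14 (t₀ lam a b c ε : ℝ) (ht₀ : 1 ≤ t₀) (hlam : 1 ≤ lam)
    (ha : 0 ≤ a) (hb : 0 ≤ b) (hc : c ∈ Set.Ioc (0 : ℝ) 1) (hε : ε ∈ Set.Ioo (0 : ℝ) 1)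
    (q : ℝ → ℝ) (hq_cont : ContinuousOn q (Set.Ici t₀))
    (hq_nonneg : ∀ t ∈ Set.Ici t₀, 0 ≤ q t)
    (hq_int : IntegrableOn (fun t => t ^ (lam + c) * q t) (Set.Ici t₀))
    (Ic : ℝ) (hIc : Ic = ∫ t in Set.Ici t₀, t ^ (lam + c) * q t)
    (h1 : lam * (a + ε) ^ (lam - 1) * Ic < c)
    (h2 : b / t₀ + (a + ε) ^ lam * Ic / (c * t₀ ^ c) < ε) :
    ∃ x x' : ℝ → ℝ,
      (∀ t ∈ Set.Ici t₀, HasDerivAt x (x' t) t ∧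
        HasDerivAt x' (-(q t * efPow lam (x t))) t) ∧
      (∀ t ∈ Set.Ici t₀, b ≤ x t) ∧
      ((fun t => x t - a * t) =O[atTop] fun t : ℝ => t ^ (1 - c)) ∧
      (∀ t ∈ Set.Ici t₀,
        a ^ lam * (1 / t) * (∫ s in t₀..t, s ^ (lam + 1) * q s) ≤ (x t - b) / t - x' t ∧
          (x t - b) / t - x' t ≤
            (a + ε) ^ lam * (1 / t ^ c) * ∫ s in t₀..t, s ^ (lam + c) * q s) ∧
      (fun t => (x t - b) / t - x' t) =O[atTop] fun t : ℝ => t ^ (-c) := by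
  have hc0 := hc.1
  have hpos : 0 < t₀ := by linarith
  have hlam0 : 0 ≤ lam := by linarith
  have hε0 := hε.1
  set Q : ℝ → ℝ := fun r => q (max r t₀)
  have hQ : Continuous Q :=
    hq_cont.comp_continuous (by fun_prop) fun r => mem_Ici.2 (le_max_right _ _)
  have hQ0 : ∀ r, 0 ≤ Q r := fun r => hq_nonneg _ (mem_Ici.2 (le_max_right _ _))
  have hQq : ∀ r ∈ Ici t₀, Q r = q r := fun r hr => congrArg q (max_eq_left hr)
  have hint : IntegrableOn (fun t => t ^ (lam + c) * Q t) (Ioi t₀) :=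
    (hq_int.mono_set Ioi_subset_Ici_self).congr_fun
      (fun r hr => by simp only [hQq r (Ioi_subset_Ici_self hr)]) measurableSet_Ioi
  have hI : Ic = ∫ t in Ioi t₀, t ^ (lam + c) * Q t := by
    rw [hIc, integral_Ici_eq_integral_Ioi]
    exact setIntegral_congr_fun measurableSet_Ioi
      fun r hr => by simp only [hQq r (Ioi_subset_Ici_self hr)]
  have hI0 : 0 ≤ Ic := by
    rw [hI]
    exact setIntegral_nonneg measurableSet_Ioi fun r hr =>
      mul_nonneg (rpow_nonneg (hpos.trans hr).le _) (hQ0 r)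
  obtain ⟨v, hvc, hmem, hv⟩ := exists_emdenFowler_integral_solution ht₀ hlam ha hb hc hε0 hQ hQ0
    hint (hI ▸ h1) (hI ▸ h2)
  rw [← hI] at hv
  have hv0 : ∀ t, 0 ≤ v t := fun t => ha.trans (hmem t).1
  have hvM : ∀ t, v t ^ lam ≤ (a + ε) ^ lam := fun t => rpow_le_rpow (hv0 t) (hmem t).2 hlam0
  have hva : ∀ t, a ^ lam ≤ v t ^ lam := fun t => rpow_le_rpow ha (hmem t).1 hlam0
  set g : ℝ → ℝ := fun r => max r t₀ ^ lam * Q r * v r ^ lam with hgdef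
  have hg : Continuous g :=
    (((by fun_prop : Continuous fun r : ℝ => max r t₀).rpow_const
      fun _ => Or.inr hlam0).mul hQ).mul (hvc.rpow_const fun _ => Or.inr hlam0)
  have hgr : ∀ r ∈ Ici t₀, g r = r ^ lam * Q r * v r ^ lam := fun r hr => by
    simp only [hgdef]
    rw [max_eq_left (mem_Ici.1 hr)]
  have hgi : IntegrableOn g (Ioi t₀) := by
    refine (hint.mul_const ((a + ε) ^ lam)).mono' hg.aestronglyMeasurable ?_
    filter_upwards [ae_restrict_mem measurableSet_Ioi] with r hr
    have hr1 : 1 ≤ r := ht₀.trans (le_of_lt hr)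
    have hr0 : 0 < r := by linarith
    have hvr := rpow_nonneg (hv0 r) lam
    have hQr := hQ0 r
    rw [hgr r (Ioi_subset_Ici_self hr), Real.norm_of_nonneg (by positivity)]
    refine mul_le_mul (mul_le_mul_of_nonneg_right ?_ hQr) (hvM r) hvr (by positivity)
    exact rpow_le_rpow_of_exponent_le hr1 (by linarith)
  set G := ∫ r in Ioi t₀, g r
  set x : ℝ → ℝ := fun t =>
    b + a * t + ((∫ r in t₀..t, r * g r) + t * (G - ∫ r in t₀..t, g r)) with hxdef
  set x' : ℝ → ℝ := fun t => a + (G - ∫ r in t₀..t, g r) with hx'def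
  have hxJ : ∀ t ∈ Ici t₀, x t = b + a * t + t * ∫ r in Ioi t₀, min (r / t) 1 * g r :=
    fun t ht => by rw [integral_Ioi_min_div_one_mul hpos ht hg hgi]
  have hxv : ∀ t ∈ Ici t₀, x t = t * v t := fun t ht => by
    have htpos : 0 < t := hpos.trans_le ht
    rw [hxJ t ht, (hv t ht).1, mul_add, mul_add, mul_div_cancel₀ _ htpos.ne', mul_comm a]
  have hdg : ∀ t, HasDerivAt (fun t => ∫ r in t₀..t, g r) (g t) t := fun t =>
    hg.integral_hasStrictDerivAt t₀ t |>.hasDerivAt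
  have hrg : Continuous fun r => r * g r := continuous_id.mul hg
  have hdrg : ∀ t, HasDerivAt (fun t => ∫ r in t₀..t, r * g r) (t * g t) t := fun t =>
    hrg.integral_hasStrictDerivAt t₀ t |>.hasDerivAt
  have hdx' : ∀ t, HasDerivAt x' (-g t) t := fun t => by
    exact ((hdg t).const_sub G).const_add a
  have hdx : ∀ t, HasDerivAt x (x' t) t := fun t => by
    have h := ((((hasDerivAt_id' t).const_mul a).const_add b).add
      ((hdrg t).add ((hasDerivAt_id' t).mul ((hdg t).const_sub G))))
    refine h.congr_deriv ?_
    simp only [hx'def]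
    ring
  have hgap : ∀ t ∈ Ici t₀, (x t - b) / t - x' t = (1 / t) * ∫ r in t₀..t, r * g r :=
    fun t ht => by
      have htpos : 0 < t := hpos.trans_le ht
      simp only [hxdef, hx'def]
      field_simp
      ring
  have hii : ∀ (p t : ℝ), t₀ ≤ t → IntervalIntegrable (fun s => s ^ p * q s) volume t₀ t :=
    fun p t ht => by
      refine ContinuousOn.intervalIntegrable ?_
      rw [uIcc_of_le ht]
      exact (continuousOn_id.rpow_const fun s hs => Or.inl (hpos.trans_le hs.1).ne').mul
        (hq_cont.mono Icc_subset_Ici_self)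
  have hbounds : ∀ t ∈ Ici t₀,
      a ^ lam * (1 / t) * (∫ s in t₀..t, s ^ (lam + 1) * q s) ≤ (x t - b) / t - x' t ∧
        (x t - b) / t - x' t ≤
          (a + ε) ^ lam * (1 / t ^ c) * ∫ s in t₀..t, s ^ (lam + c) * q s := fun t ht => by
    have htpos : 0 < t := hpos.trans_le ht
    rw [hgap t ht, ← intervalIntegral.integral_const_mul, ← intervalIntegral.integral_const_mul,
      ← intervalIntegral.integral_const_mul]
    refine ⟨intervalIntegral.integral_mono_on ht ((hii _ _ ht).const_mul _)
      ((hrg.const_mul _).intervalIntegrable _ _) fun s hs => ?_,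
      intervalIntegral.integral_mono_on ht ((hrg.const_mul _).intervalIntegrable _ _)
      ((hii _ _ ht).const_mul _) fun s hs => ?_⟩
    · have hs0 : 0 < s := hpos.trans_le hs.1
      have hqs := hq_nonneg s hs.1
      rw [hgr s hs.1, hQq s hs.1, rpow_add_one hs0.ne']
      have := mul_le_mul_of_nonneg_left (hva s)
        (by positivity : 0 ≤ 1 / t * (s * (s ^ lam * q s)))
      linarith
    · have hs0 : 0 < s := hpos.trans_le hs.1
      have hqs := hq_nonneg s hs.1
      have hvs := rpow_nonneg (hv0 s) lam
      have hker := min_div_one_le_rpow hs0 htpos hc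
      rw [min_eq_left ((div_le_one htpos).2 hs.2), rpow_neg htpos.le] at hker
      rw [hgr s hs.1, hQq s hs.1, rpow_add hs0]
      have := mul_le_mul (mul_le_mul_of_nonneg_right hker
        (by positivity : 0 ≤ s ^ lam * q s)) (hvM s) hvs (by positivity)
      calc 1 / t * (s * (s ^ lam * q s * v s ^ lam))
          = s / t * (s ^ lam * q s) * v s ^ lam := by ring
        _ ≤ _ := this
        _ = _ := by ring
  refine ⟨x, x', fun t ht => ⟨hdx t, ?_⟩, fun t ht => ?_, ?_, hbounds, ?_⟩
  · have htpos : 0 < t := hpos.trans_le ht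
    have hef : q t * efPow lam (x t) = g t := by
      rw [hxv t ht, efPow_of_nonneg hlam (mul_nonneg htpos.le (hv0 t)), hgr t ht, hQq t ht,
        mul_rpow htpos.le (hv0 t)]
      ring
    rw [hef]
    exact hdx' t
  · have htpos : 0 < t := hpos.trans_le ht
    rw [hxJ t ht]
    have := mul_nonneg htpos.le (hv t ht).2.1
    have := mul_nonneg ha htpos.le
    linarith
  · refine IsBigO.of_bound (b + (a + ε) ^ lam * Ic) ?_
    filter_upwards [eventually_ge_atTop t₀] with t ht
    have htpos : 0 < t := hpos.trans_le ht
    obtain ⟨-, hJ0, hJle⟩ := hv t ht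
    have hx : x t - a * t = b + t * ∫ r in Ioi t₀, min (r / t) 1 * g r := by
      rw [hxJ t ht]
      ring
    have hle := mul_le_mul_of_nonneg_left hJle htpos.le
    have hone : 1 ≤ t ^ (1 - c) := one_le_rpow (ht₀.trans ht) (by linarith [hc.2])
    have hsplit : t ^ (1 - c) = t * t ^ (-c) := by
      rw [sub_eq_add_neg, rpow_add htpos, rpow_one]
    rw [hx, Real.norm_of_nonneg (add_nonneg hb (mul_nonneg htpos.le hJ0)),
      Real.norm_of_nonneg (by positivity)]
    have hbt := mul_le_mul_of_nonneg_left hone hb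
    calc _ ≤ b * t ^ (1 - c) + t * ((a + ε) ^ lam * Ic * t ^ (-c)) := by linarith
      _ = _ := by rw [hsplit]; ring
  · refine IsBigO.of_bound ((a + ε) ^ lam * Ic) ?_
    filter_upwards [eventually_ge_atTop t₀] with t ht
    have htpos : 0 < t := hpos.trans_le ht
    have hlow : 0 ≤ (x t - b) / t - x' t := by
      refine le_trans ?_ (hbounds t ht).1
      refine mul_nonneg (by positivity) (intervalIntegral.integral_nonneg ht fun s hs => ?_)
      exact mul_nonneg (rpow_nonneg (hpos.trans_le hs.1).le _) (hq_nonneg s hs.1)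
    have hIle : ∫ s in t₀..t, s ^ (lam + c) * q s ≤ Ic := by
      rw [hIc, intervalIntegral.integral_of_le ht]
      refine setIntegral_mono_set hq_int ?_
        (Ioc_subset_Ioi_self.trans Ioi_subset_Ici_self).eventuallyLE
      filter_upwards [ae_restrict_mem measurableSet_Ici] with s hs
      exact mul_nonneg (rpow_nonneg (hpos.trans_le hs).le _) (hq_nonneg s hs)
    rw [Real.norm_of_nonneg hlow, Real.norm_of_nonneg (by positivity), rpow_neg htpos.le]
    refine (hbounds t ht).2.trans ?_
    calc _ ≤ (a + ε) ^ lam * (1 / t ^ c) * Ic :=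
          mul_le_mul_of_nonneg_left hIle (by positivity)
      _ = _ := by ring
end
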